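/- There is an absolute constant C ≥ 1 such that the following holds. Let p be an odd prime, Γ ⊆ F_p^* a multiplicative subgroup, and Q ⊆ F_p^* a set with QΓ = Q and |Q|²|Γ| ≤ p². If k ≥ 1 is an integer with 2^{64k} C⁴ ≤ |Γ| and |Γ|^{(k+2)/2} ≥ |Q| (log|Q|)^{4k}, then E⁺_{2^{k+1}}(Q) ≤ (2⁸ C)^{k+1} · |Q|^{2^{k+1}} · |Γ|^{1/2}. -/

import Mathlib

open Finset Pointwise

/-- `Γ` is a multiplicative subgroup of `F_p^*` (as a finite set of field elements). -/
def IsMulSubgroup {F : Type*} [Field F] [DecidableEq F] (Γ : Finset F) : Prop :=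
  (0 : F) ∉ Γ ∧ (1 : F) ∈ Γ ∧ (∀ x ∈ Γ, ∀ y ∈ Γ, x * y ∈ Γ) ∧ (∀ x ∈ Γ, x⁻¹ ∈ Γ)

/-- `r_{Q−Q}(x) = #{(q,q') ∈ Q×Q : q−q' = x}`. -/
def rsub {G : Type*} [AddCommGroup G] [DecidableEq G] (A : Finset G) (x : G) : ℕ :=
  ((A ×ˢ A).filter fun ab => ab.1 - ab.2 = x).card

/-- `E⁺_m(Q) = Σ_x r_{Q−Q}(x)^m`. -/
def Ek {G : Type*} [AddCommGroup G] [DecidableEq G] [Fintype G] (m : ℕ) (A : Finset G) : ℕ :=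
  ∑ x : G, (rsub A x) ^ m

namespace SkewLines
open MvPolynomial

theorem aeval_cons_eq_eval₂ {K A : Type*} [CommRing K] [CommRing A] [Algebra K A] {n : ℕ}
    (a : A) (v : Fin n → A) (f : MvPolynomial (Fin (n + 1)) K) :
    aeval (Fin.cons a v : Fin (n + 1) → A) f =
      (finSuccEquiv K n f).eval₂ (aeval v : MvPolynomial (Fin n) K →ₐ[K] A).toRingHom a := by
  induction f using MvPolynomial.induction_on with
  | C c =>
    have : finSuccEquiv K n (C c) = Polynomial.C (C c) := by simp [finSuccEquiv_apply]
    simp [this]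
  | add p q hp hq => simp [hp, hq, Polynomial.eval₂_add]
  | mul_X p i hp =>
    rw [map_mul, map_mul, Polynomial.eval₂_mul, hp]
    congr 1
    refine Fin.cases ?_ (fun j => ?_) i
    · simp [finSuccEquiv_X_zero]
    · simp [finSuccEquiv_X_succ]

theorem card_le_totalDegree_of_vanishing {K : Type*} [Field K] (R : MvPolynomial (Fin 2) K)
    (hR : R ≠ 0) (Z : Finset K)
    (hZ : ∀ z ∈ Z, aeval ![Polynomial.C z, Polynomial.X] R = 0) : Z.card ≤ R.totalDegree := by
  classical
  set ψ : MvPolynomial (Fin 1) K →ₐ[K] Polynomial K := aeval ![Polynomial.X] with hψ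
  have hinj : Function.Injective ψ := by
    have hl : (Polynomial.aeval (X 0 : MvPolynomial (Fin 1) K)).comp ψ = AlgHom.id K _ := by
      ext i
      fin_cases i
      simp [hψ]
    intro a b hab
    have h1 := congrArg (fun φ : MvPolynomial (Fin 1) K →ₐ[K] MvPolynomial (Fin 1) K => φ a) hl
    have h2 := congrArg (fun φ : MvPolynomial (Fin 1) K →ₐ[K] MvPolynomial (Fin 1) K => φ b) hl
    simp only [AlgHom.comp_apply, AlgHom.id_apply] at h1 h2
    rw [← h1, ← h2, hab]
  set P := (finSuccEquiv K 1 R).map ψ.toRingHom with hP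
  have hP0 : P ≠ 0 := by
    rw [hP, Ne, Polynomial.map_eq_zero_iff hinj]
    simpa using hR
  have hroot : Z.image Polynomial.C ⊆ P.roots.toFinset := by
    intro c hc
    obtain ⟨z, hz, rfl⟩ := Finset.mem_image.mp hc
    rw [Multiset.mem_toFinset, Polynomial.mem_roots hP0, Polynomial.IsRoot, hP,
      Polynomial.eval_map, ← aeval_cons_eq_eval₂]
    exact hZ z hz
  calc Z.card = (Z.image Polynomial.C).card :=
        (Finset.card_image_of_injective _ Polynomial.C_injective).symm
    _ ≤ P.roots.toFinset.card := Finset.card_le_card hroot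
    _ ≤ P.natDegree := (Multiset.toFinset_card_le _).trans (Polynomial.card_roots' _)
    _ ≤ (finSuccEquiv K 1 R).natDegree := Polynomial.natDegree_map_le
    _ ≤ R.totalDegree := by rw [natDegree_finSuccEquiv]; exact degreeOf_le_totalDegree _ _

theorem totalDegree_coeff_finSuccEquiv_le {K : Type*} [CommRing K] {n : ℕ}
    (f : MvPolynomial (Fin (n + 1)) K) (i : ℕ) :
    ((finSuccEquiv K n f).coeff i).totalDegree ≤ f.totalDegree := by
  by_cases h : (finSuccEquiv K n f).coeff i = 0
  · simp [h]
  · have := totalDegree_coeff_finSuccEquiv_add_le f i h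
    omega

theorem natDegree_finSuccEquiv_le {K : Type*} [CommRing K] {n : ℕ}
    (f : MvPolynomial (Fin (n + 1)) K) :
    (finSuccEquiv K n f).natDegree ≤ f.totalDegree := by
  rw [natDegree_finSuccEquiv]; exact degreeOf_le_totalDegree _ _

theorem totalDegree_det_le {σ R : Type*} [CommRing R] {n : ℕ}
    (M : Matrix (Fin n) (Fin n) (MvPolynomial σ R)) (c : Fin n → ℕ)
    (h : ∀ i j, (M i j).totalDegree ≤ c j) : M.det.totalDegree ≤ ∑ j, c j := by
  rw [Matrix.det_apply]
  refine totalDegree_finsetSum_le fun s _ => ?_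
  refine (totalDegree_smul_le _ _).trans ?_
  exact (totalDegree_finsetProd _ _).trans (Finset.sum_le_sum fun i _ => h _ _)

theorem totalDegree_resultant_le {K : Type*} [CommRing K] (f g : MvPolynomial (Fin 3) K) :
    (((finSuccEquiv K 2 f)).resultant (finSuccEquiv K 2 g)).totalDegree ≤
      2 * f.totalDegree * g.totalDegree := by
  rw [Polynomial.resultant]
  refine (totalDegree_det_le _
    (Fin.addCases (fun _ => g.totalDegree) (fun _ => f.totalDegree)) ?_).trans ?_
  · intro i j
    refine Fin.addCases (fun j => ?_) (fun j => ?_) j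
    · simp only [Polynomial.sylvester, Matrix.of_apply, Fin.addCases_left]
      split_ifs
      · exact totalDegree_coeff_finSuccEquiv_le _ _
      · simp
    · simp only [Polynomial.sylvester, Matrix.of_apply, Fin.addCases_right]
      split_ifs
      · exact totalDegree_coeff_finSuccEquiv_le _ _
      · simp
  · rw [Fin.sum_univ_add]
    simp only [Fin.addCases_left, Fin.addCases_right, Finset.sum_const, Finset.card_univ,
      Fintype.card_fin, smul_eq_mul]
    have h1 := Nat.mul_le_mul_right g.totalDegree (natDegree_finSuccEquiv_le f)
    have h2 := Nat.mul_le_mul_right f.totalDegree (natDegree_finSuccEquiv_le g)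
    nlinarith

/-- The ring map restricting a polynomial in `(y, z, x)` to the line
`y = α x + β`, `z = c`. -/
noncomputable def restrA {K : Type*} [Field K] (α β c : K) :
    MvPolynomial (Fin 3) K →ₐ[K] Polynomial K :=
  aeval ![Polynomial.C α * Polynomial.X + Polynomial.C β, Polynomial.C c, Polynomial.X]

/-- The ring map restricting a polynomial in `(y, z, x)` to the line
`y = c`, `z = γ x + δ`. -/
noncomputable def restrB {K : Type*} [Field K] (c γ δ : K) :
    MvPolynomial (Fin 3) K →ₐ[K] Polynomial K :=
  aeval ![Polynomial.C c, Polynomial.C γ * Polynomial.X + Polynomial.C δ, Polynomial.X]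

theorem card_common_lines_le {K : Type*} [Field K] (f g : MvPolynomial (Fin 3) K)
    (hf : Irreducible f) (hfg : ¬ f ∣ g) (Z : Finset K)
    (hZ : ∀ c ∈ Z, ∃ α β, restrA α β c f = 0 ∧ restrA α β c g = 0) :
    Z.card ≤ 2 * f.totalDegree * g.totalDegree := by
  classical
  set e := finSuccEquiv K 2 with he
  have hg0 : g ≠ 0 := fun h => hfg (h ▸ dvd_zero f)
  have hirr : Irreducible (e f) := (MulEquiv.irreducible_iff e).mpr hf
  have hndvd : ¬ e f ∣ e g := by rwa [map_dvd_iff]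
  have key : ∀ α β c, ∀ h : MvPolynomial (Fin 3) K, restrA α β c h =
      (e h).eval₂ (aeval ![Polynomial.C c, Polynomial.X] :
        MvPolynomial (Fin 2) K →ₐ[K] Polynomial K).toRingHom
        (Polynomial.C α * Polynomial.X + Polynomial.C β) := by
    intro α β c h
    exact aeval_cons_eq_eval₂ _ _ h
  rcases Nat.eq_zero_or_pos g.totalDegree with hgd | hgd
  · suffices Z = ∅ by simp [this]
    rw [Finset.eq_empty_iff_forall_notMem]
    intro c hc
    obtain ⟨α, β, -, h⟩ := hZ c hc
    rw [totalDegree_eq_zero_iff_eq_C] at hgd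
    rw [hgd] at h hg0
    apply hg0
    rw [restrA] at h
    simpa using h
  rcases Nat.eq_zero_or_pos (e f).natDegree with hd | hd
  · obtain ⟨c₀, hc₀⟩ := Polynomial.natDegree_eq_zero.mp hd
    have hc₀0 : c₀ ≠ 0 := by
      rintro rfl
      exact hirr.ne_zero (by rw [← hc₀]; simp)
    have h1 := card_le_totalDegree_of_vanishing c₀ hc₀0 Z (by
      intro c hc
      obtain ⟨α, β, h, -⟩ := hZ c hc
      rw [key, ← hc₀] at h
      simpa using h)
    have h2 := totalDegree_coeff_finSuccEquiv_le f 0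
    rw [← he, ← hc₀, Polynomial.coeff_C_zero] at h2
    nlinarith
  · have hprim := hirr.isPrimitive hd.ne'
    let F := FractionRing (MvPolynomial (Fin 2) K)
    have hirr' : Irreducible ((e f).map (algebraMap _ F)) :=
      hprim.irreducible_iff_irreducible_map_fraction_map.mp hirr
    have hcop : IsCoprime ((e f).map (algebraMap _ F)) ((e g).map (algebraMap _ F)) := by
      rw [hirr'.coprime_iff_not_dvd]
      intro h
      exact hndvd (hprim.dvd_of_fraction_map_dvd_fraction_map h)
    have hinj : Function.Injective (algebraMap (MvPolynomial (Fin 2) K) F) :=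
      IsFractionRing.injective _ _
    have hres : (e f).resultant (e g) ≠ 0 := by
      have := Polynomial.resultant_ne_zero _ _ hcop
      rw [Polynomial.natDegree_map_eq_of_injective hinj,
        Polynomial.natDegree_map_eq_of_injective hinj, Polynomial.resultant_map_map] at this
      intro h
      exact this (by rw [h, map_zero])
    obtain ⟨A, B, -, -, hAB⟩ := Polynomial.exists_mul_add_mul_eq_C_resultant
      (e f) (e g) le_rfl le_rfl (Or.inl hd.ne')
    refine (card_le_totalDegree_of_vanishing _ hres Z ?_).trans (totalDegree_resultant_le f g)
    intro c hc
    obtain ⟨α, β, h1, h2⟩ := hZ c hc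
    rw [key] at h1 h2
    have := congrArg (Polynomial.eval₂ (aeval ![Polynomial.C c, Polynomial.X] :
        MvPolynomial (Fin 2) K →ₐ[K] Polynomial K).toRingHom
        (Polynomial.C α * Polynomial.X + Polynomial.C β)) hAB
    rw [Polynomial.eval₂_add, Polynomial.eval₂_mul, Polynomial.eval₂_mul, h1, h2,
      Polynomial.eval₂_C] at this
    simpa using this.symm

theorem derivation_aeval {K A σ : Type*} [CommRing K] [CommRing A] [Algebra K A] [Fintype σ]
    (δ : Derivation K A A) (v : σ → A) (h : MvPolynomial σ K) :
    δ (aeval v h) = ∑ i, aeval v (pderiv i h) * δ (v i) := by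
  classical
  induction h using MvPolynomial.induction_on with
  | C c => simp
  | add p q hp hq => simp [hp, hq, add_mul, Finset.sum_add_distrib]
  | mul_X p i hp =>
    simp only [map_mul, aeval_X, Derivation.leibniz, hp, smul_eq_mul, map_add, pderiv_X,
      add_mul, Finset.sum_add_distrib, Finset.mul_sum]
    congr 1
    · rw [Finset.sum_eq_single i]
      · simp
      · intro j _ hj
        simp [hj.symm]
      · simp
    · exact Finset.sum_congr rfl fun j _ => by ring

/-- The derivation of `A[s]` acting coefficientwise. -/
noncomputable def coeffDerivation {K A : Type*} [CommRing K] [CommRing A] [Algebra K A]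
    (D : Derivation K A A) : Derivation K (Polynomial A) (Polynomial A) :=
  Derivation.mk'
    { toFun := fun P => PolynomialModule.equivPolynomialSelf (D.mapCoeffs P)
      map_add' := by intros; simp
      map_smul' := by
        intro c P
        ext i
        change D ((c • P).coeff i) = (c • PolynomialModule.equivPolynomialSelf (D.mapCoeffs P)).coeff i
        rw [Polynomial.coeff_smul, Polynomial.coeff_smul, Derivation.map_smul]
        rfl }
    (by
      intro a b
      change PolynomialModule.equivPolynomialSelf (D.mapCoeffs (a * b)) =
        a • PolynomialModule.equivPolynomialSelf (D.mapCoeffs b) +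
          b • PolynomialModule.equivPolynomialSelf (D.mapCoeffs a)
      rw [Derivation.leibniz, map_add, LinearEquiv.map_smul, LinearEquiv.map_smul])

theorem coeff_coeffDerivation {K A : Type*} [CommRing K] [CommRing A] [Algebra K A]
    (D : Derivation K A A) (P : Polynomial A) (i : ℕ) :
    (coeffDerivation D P).coeff i = D (P.coeff i) := rfl

/-- Numerator of the second derivative of `f` along the direction `(-f_x, 0, f_y)`. -/
noncomputable def flexForm {K : Type*} [Field K] (f : MvPolynomial (Fin 3) K) :
    MvPolynomial (Fin 3) K :=
  pderiv 2 (pderiv 2 f) * (pderiv 0 f) ^ 2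
    - 2 * pderiv 2 (pderiv 0 f) * pderiv 2 f * pderiv 0 f
    + pderiv 0 (pderiv 0 f) * (pderiv 2 f) ^ 2

theorem pderiv_comm' {K : Type*} [Field K] (f : MvPolynomial (Fin 3) K) :
    pderiv 0 (pderiv 2 f) = pderiv 2 (pderiv 0 f) := by
  have h : ⁅(pderiv 0 : Derivation K (MvPolynomial (Fin 3) K) (MvPolynomial (Fin 3) K)),
      (pderiv 2 : Derivation K (MvPolynomial (Fin 3) K) (MvPolynomial (Fin 3) K))⁆ = 0 := by
    apply derivation_ext
    intro i
    simp only [Derivation.commutator_apply, pderiv_X, Derivation.zero_apply]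
    fin_cases i <;> simp
  have := congrArg (fun d : Derivation K (MvPolynomial (Fin 3) K) (MvPolynomial (Fin 3) K) => d f) h
  simpa [Derivation.commutator_apply, sub_eq_zero] using this

theorem ruling_coeff_dvd {K : Type*} [Field K] (p : ℕ) [CharP K p]
    (f : MvPolynomial (Fin 3) K) (hf : Irreducible f) (hflex : f ∣ flexForm f)
    (hfy : ¬ f ∣ pderiv 0 f) (v : Fin 3 → Polynomial (MvPolynomial (Fin 3) K))
    (hv : v = ![Polynomial.C (X 0) - Polynomial.X * Polynomial.C (pderiv 2 f), Polynomial.C (X 1),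
      Polynomial.C (X 2) + Polynomial.X * Polynomial.C (pderiv 0 f)]) (j : ℕ) (hj : j < p) :
    f ∣ (aeval v f).coeff j := by
  set fy := pderiv 0 f with hfy'
  set fx := pderiv 2 f with hfx'
  set D : Derivation K (MvPolynomial (Fin 3) K) (MvPolynomial (Fin 3) K) :=
    mkDerivation K ![-fx, 0, fy] with hD
  have hDX0 : D (X 0) = -fx := by simp [hD, mkDerivation_X]
  have hDX1 : D (X 1) = 0 := by simp [hD, mkDerivation_X]
  have hDX2 : D (X 2) = fy := by simp [hD, mkDerivation_X]
  have hDh : ∀ h, D h = pderiv 0 h * (-fx) + pderiv 2 h * fy := by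
    intro h
    have := derivation_aeval D X h
    rw [aeval_X_left_apply, Fin.sum_univ_three, hDX0, hDX1, hDX2] at this
    simpa using this
  have hDf : D f = 0 := by rw [hDh, ← hfy', ← hfx']; ring
  set P := D fy with hP
  have hμx : fy * D (-fx) = -(P * fx) - flexForm f := by
    rw [map_neg, hP, hDh, hDh, flexForm, ← hfy', ← hfx', hfx', pderiv_comm', ← hfx', ← hfy']
    ring
  set φ := aeval v f with hφ
  set E := aeval (R := K) v with hE
  have hv0 : v 0 = Polynomial.C (X 0) - Polynomial.X * Polynomial.C fx := by rw [hv]; rfl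
  have hv1 : v 1 = Polynomial.C (X 1) := by rw [hv]; rfl
  have hv2 : v 2 = Polynomial.C (X 2) + Polynomial.X * Polynomial.C fy := by rw [hv]; rfl
  set Dh := coeffDerivation D with hDh'
  have hDhC : ∀ a, Dh (Polynomial.C a) = Polynomial.C (D a) := by
    intro a
    ext1 i
    rw [hDh', coeff_coeffDerivation, Polynomial.coeff_C, Polynomial.coeff_C]
    split_ifs <;> simp
  have hDhX : Dh Polynomial.X = 0 := by
    ext1 i
    rw [hDh', coeff_coeffDerivation, Polynomial.coeff_X]
    split_ifs <;> simp
  have h1 : Dh φ = E fy * (Polynomial.C (-fx) + Polynomial.X * Polynomial.C (D (-fx)))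
      + E fx * (Polynomial.C fy + Polynomial.X * Polynomial.C P) := by
    rw [hφ, derivation_aeval, Fin.sum_univ_three, hv0, hv1, hv2]
    simp only [map_sub, map_add, Derivation.leibniz, hDhC, hDhX, hDX0, hDX1, hDX2, smul_eq_mul,
      map_zero, mul_zero, add_zero, map_neg]
    ring
  have h2 : Polynomial.derivative φ = E fy * (- Polynomial.C fx) + E fx * Polynomial.C fy := by
    have := derivation_aeval
      ((Polynomial.derivative' (R := MvPolynomial (Fin 3) K)).restrictScalars K) v f
    simp only [Derivation.restrictScalars_apply, Polynomial.derivative'_apply] at this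
    rw [hφ, this, Fin.sum_univ_three, hv0, hv1, hv2]
    simp
    ring
  have h3 : Polynomial.C fy * Dh φ =
      (Polynomial.C fy + Polynomial.X * Polynomial.C P) * Polynomial.derivative φ
        - Polynomial.X * (E fy * Polynomial.C (flexForm f)) := by
    rw [h1, h2]
    have hC : Polynomial.C fy * Polynomial.C (D (-fx)) =
        -(Polynomial.C P * Polynomial.C fx) - Polynomial.C (flexForm f) := by
      rw [← Polynomial.C_mul, hμx]
      simp
    rw [Polynomial.C_neg]
    linear_combination (Polynomial.X * E fy) * hC
  have hcoeff : ∀ j, f ∣ fy * D (φ.coeff j)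
      - (fy * (φ.coeff (j + 1) * (j + 1)) + P * (φ.coeff j * j)) := by
    intro j
    have := congrArg (fun Q => Q.coeff j) h3
    simp only [Polynomial.coeff_C_mul, Polynomial.coeff_sub, add_mul, Polynomial.coeff_add,
      Polynomial.coeff_derivative, mul_assoc] at this
    rw [hDh', coeff_coeffDerivation] at this
    obtain ⟨w, hw⟩ := hflex
    cases j with
    | zero =>
      simp only [Polynomial.coeff_X_mul_zero] at this
      rw [this]
      simp
    | succ n =>
      simp only [Polynomial.coeff_X_mul, Polynomial.coeff_C_mul, Polynomial.coeff_derivative,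
        Polynomial.coeff_mul_C] at this
      rw [this, hw]
      refine ⟨-((E fy).coeff n * w), ?_⟩
      push_cast
      ring
  have hprime : Prime f := hf.prime
  induction j with
  | zero =>
    have h0 : φ.coeff 0 = f := by
      rw [Polynomial.coeff_zero_eq_eval_zero]
      have hcomp : ((Polynomial.aeval (0 : MvPolynomial (Fin 3) K)).restrictScalars K).comp E
          = AlgHom.id K _ := by
        apply MvPolynomial.algHom_ext
        intro i
        fin_cases i
        · simp [hE, hv0]
        · simp [hE, hv1]
        · simp [hE, hv2]
      have := congrArg (fun g : MvPolynomial (Fin 3) K →ₐ[K] _ => g f) hcomp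
      simpa [Polynomial.aeval_def, Polynomial.eval₂_eq_eval_map] using this
    rw [h0]
  | succ n ih =>
    obtain ⟨w, hw⟩ := ih (by omega)
    have hd := hcoeff n
    rw [hw, Derivation.leibniz, hDf, smul_zero, add_zero, smul_eq_mul] at hd
    have hd' : f ∣ fy * (φ.coeff (n + 1) * (n + 1)) := by
      have h4 : f ∣ fy * (f * D w) - P * (f * w * n) := ⟨fy * D w - P * w * n, by ring⟩
      have := dvd_sub h4 hd
      ring_nf at this ⊢
      exact this
    rcases hprime.dvd_or_dvd hd' with h | h
    · exact absurd h hfy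
    rcases hprime.dvd_or_dvd h with h | h
    · exact h
    · exfalso
      have hne : ((n + 1 : ℕ) : K) ≠ 0 := by
        rw [Ne, CharP.cast_eq_zero_iff K p]
        exact Nat.not_dvd_of_pos_of_lt (by omega) hj
      apply hf.not_isUnit
      refine isUnit_of_dvd_unit h ?_
      have : (n : MvPolynomial (Fin 3) K) + 1 = C ((n + 1 : ℕ) : K) := by simp
      rw [this]
      exact (isUnit_iff_ne_zero.mpr hne).map C

theorem ruling_line {K : Type*} [Field K] (p : ℕ) [CharP K p]
    (f : MvPolynomial (Fin 3) K) (hf : Irreducible f) (hflex : f ∣ flexForm f)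
    (hdeg : f.totalDegree < p) (q : Fin 3 → K) (hq : eval q f = 0)
    (hqy : eval q (pderiv 0 f) ≠ 0) :
    restrA (-(eval q (pderiv 2 f)) / eval q (pderiv 0 f))
      (q 0 + eval q (pderiv 2 f) / eval q (pderiv 0 f) * q 2) (q 1) f = 0 := by
  have hfy : ¬ f ∣ pderiv 0 f := by
    rintro ⟨w, hw⟩
    apply hqy
    rw [hw, map_mul, hq, zero_mul]
  set v : Fin 3 → Polynomial (MvPolynomial (Fin 3) K) :=
    ![Polynomial.C (X 0) - Polynomial.X * Polynomial.C (pderiv 2 f), Polynomial.C (X 1),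
      Polynomial.C (X 2) + Polynomial.X * Polynomial.C (pderiv 0 f)] with hv
  have hvdeg : ∀ i, (v i).natDegree ≤ 1 := by
    intro i
    fin_cases i
    · simp only [hv, Fin.zero_eta, Matrix.cons_val_zero]
      compute_degree
    · simp [hv]
    · simp only [hv]
      change (Polynomial.C (X 2) + Polynomial.X * Polynomial.C (pderiv 0 f)).natDegree ≤ 1
      compute_degree
  have hdvd : ∀ j, f ∣ (aeval v f).coeff j := by
    intro j
    by_cases hj : j < p
    · exact ruling_coeff_dvd p f hf hflex hfy v hv j hj
    · rw [Polynomial.coeff_eq_zero_of_natDegree_lt]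
      · exact dvd_zero f
      · have h1 := aeval_natDegree_le (map (C : K →+* MvPolynomial (Fin 3) K) f)
          (m := f.totalDegree) (Finset.sup_mono (support_map_subset C f)) v hvdeg
        have h2 : aeval v (map (C : K →+* MvPolynomial (Fin 3) K) f) = aeval v f :=
          aeval_map_algebraMap _ v f
        rw [h2] at h1
        omega
  have hmap : (aeval v f).map (eval q) = 0 := by
    ext j
    obtain ⟨w, hw⟩ := hdvd j
    rw [Polynomial.coeff_map, hw, map_mul, hq, zero_mul, Polynomial.coeff_zero]
  set b := eval q (pderiv 0 f) with hb
  set a := eval q (pderiv 2 f) with ha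
  have hcomp : restrA (-a / b) (q 0 + a / b * q 2) (q 1) =
      ((Polynomial.aeval (R := K) (Polynomial.C b⁻¹ * (Polynomial.X - Polynomial.C (q 2)))).comp
        (Polynomial.mapAlgHom (aeval q))).comp (aeval v) := by
    apply MvPolynomial.algHom_ext
    intro i
    have hbb : Polynomial.C b⁻¹ * Polynomial.C b = (1 : Polynomial K) := by
      rw [← Polynomial.C_mul, inv_mul_cancel₀ hqy, Polynomial.C_1]
    fin_cases i
    · simp [restrA, hv, ← ha, div_eq_mul_inv]
      ring
    · simp [restrA, hv]
    · simp [restrA, hv, ← hb]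
      linear_combination (-(Polynomial.X - Polynomial.C (q 2))) * hbb
  rw [hcomp, AlgHom.comp_apply, AlgHom.comp_apply]
  have : (Polynomial.mapAlgHom (aeval q)) (aeval v f) = (aeval v f).map (eval q) := by
    simp only [Polynomial.coe_mapAlgHom]
    congr 1
  rw [this, hmap, map_zero]

theorem totalDegree_pderiv_le {K σ : Type*} [CommRing K] (i : σ) (f : MvPolynomial σ K) :
    (pderiv i f).totalDegree ≤ f.totalDegree := by
  classical
  refine Finset.sup_le fun m hm => ?_
  rw [mem_support_iff, coeff_pderiv] at hm
  have hm' : m + Finsupp.single i 1 ∈ f.support := by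
    rw [mem_support_iff]
    intro h
    exact hm (by rw [h, zero_mul])
  refine le_trans ?_ (le_totalDegree hm')
  rw [Finsupp.sum_add_index' (by simp) (by simp)]
  exact Nat.le_add_right _ _

theorem finSuccEquiv_pderiv_zero {K : Type*} [CommRing K] {n : ℕ}
    (f : MvPolynomial (Fin (n + 1)) K) :
    finSuccEquiv K n (pderiv 0 f) = Polynomial.derivative (finSuccEquiv K n f) := by
  induction f using MvPolynomial.induction_on with
  | C c =>
    have : finSuccEquiv K n (C c) = Polynomial.C (C c) := by simp [finSuccEquiv_apply]
    simp [this]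
  | add p q hp hq => simp [hp, hq]
  | mul_X p i hp =>
    refine Fin.cases ?_ (fun j => ?_) i
    · simp [Derivation.leibniz, hp, finSuccEquiv_X_zero]
      ring
    · simp [Derivation.leibniz, hp, finSuccEquiv_X_succ, pderiv_X]
      ring

section restr
variable {K : Type*} [Field K]

theorem natDegree_restrA_le (α β c : K) (f : MvPolynomial (Fin 3) K) :
    (restrA α β c f).natDegree ≤ f.totalDegree := by
  refine (aeval_natDegree_le f le_rfl _ (n := 1) fun i => ?_).trans (by simp)
  fin_cases i
  · simp only [Fin.zero_eta, Matrix.cons_val_zero]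
    compute_degree
  · simp
  · simp

theorem natDegree_restrB_le (c γ δ : K) (f : MvPolynomial (Fin 3) K) :
    (restrB c γ δ f).natDegree ≤ f.totalDegree := by
  refine (aeval_natDegree_le f le_rfl _ (n := 1) fun i => ?_).trans (by simp)
  fin_cases i
  · simp
  · simp only [Fin.mk_one, Matrix.cons_val_one, Matrix.cons_val_zero]
    compute_degree
  · simp

theorem eval_restrA (α β c x : K) (f : MvPolynomial (Fin 3) K) :
    (restrA α β c f).eval x = eval ![α * x + β, c, x] f := by
  have : ((Polynomial.aeval x).comp (restrA α β c)) = aeval ![α * x + β, c, x] := by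
    apply MvPolynomial.algHom_ext
    intro i
    fin_cases i <;> simp [restrA]
  have := congrArg (fun φ : MvPolynomial (Fin 3) K →ₐ[K] K => φ f) this
  simpa [MvPolynomial.aeval_eq_eval, Polynomial.coe_aeval_eq_eval] using this

theorem eval_restrB (c γ δ x : K) (f : MvPolynomial (Fin 3) K) :
    (restrB c γ δ f).eval x = eval ![c, γ * x + δ, x] f := by
  have : ((Polynomial.aeval x).comp (restrB c γ δ)) = aeval ![c, γ * x + δ, x] := by
    apply MvPolynomial.algHom_ext
    intro i
    fin_cases i <;> simp [restrB]
  have := congrArg (fun φ : MvPolynomial (Fin 3) K →ₐ[K] K => φ f) this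
  simpa [MvPolynomial.aeval_eq_eval, Polynomial.coe_aeval_eq_eval] using this

theorem derivative_restrA (α β c : K) (f : MvPolynomial (Fin 3) K) :
    Polynomial.derivative (restrA α β c f) =
      restrA α β c (pderiv 0 f) * Polynomial.C α + restrA α β c (pderiv 2 f) := by
  have := derivation_aeval (Polynomial.derivative' (R := K))
    ![Polynomial.C α * Polynomial.X + Polynomial.C β, Polynomial.C c, Polynomial.X] f
  rw [Fin.sum_univ_three] at this
  simpa [restrA] using this

theorem restrA_pderiv_of_eq_zero {α β c : K} {f : MvPolynomial (Fin 3) K}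
    (h : restrA α β c f = 0) :
    restrA α β c (pderiv 2 f) = -(Polynomial.C α * restrA α β c (pderiv 0 f)) := by
  have := derivative_restrA α β c f
  rw [h, Polynomial.derivative_zero] at this
  linear_combination -this

theorem restrA_flexForm_of_eq_zero {α β c : K} {f : MvPolynomial (Fin 3) K}
    (h : restrA α β c f = 0) : restrA α β c (flexForm f) = 0 := by
  have h1 := restrA_pderiv_of_eq_zero h
  have h2 := derivative_restrA α β c (pderiv 2 f)
  have h3 := derivative_restrA α β c (pderiv 0 f)
  rw [h1] at h2
  simp only [Polynomial.derivative_neg, Polynomial.derivative_C_mul] at h2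
  rw [pderiv_comm'] at h2
  rw [h3] at h2
  simp only [flexForm, map_add, map_sub, map_mul, map_pow, map_ofNat, h1]
  linear_combination (-(restrA α β c (pderiv 0 f)) ^ 2) * h2

theorem totalDegree_flexForm_le (f : MvPolynomial (Fin 3) K) :
    (flexForm f).totalDegree ≤ 3 * f.totalDegree := by
  have a := fun i => totalDegree_pderiv_le i f
  have b := fun i j => (totalDegree_pderiv_le i (pderiv j f)).trans (a j)
  have hpow : ∀ i, (pderiv i f ^ 2).totalDegree ≤ 2 * f.totalDegree := fun i =>
    (totalDegree_pow _ _).trans (Nat.mul_le_mul_left 2 (a i))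
  have h2 : (2 : MvPolynomial (Fin 3) K).totalDegree = 0 := by
    have : (2 : MvPolynomial (Fin 3) K) = C 2 :=
      (map_ofNat (C : K →+* MvPolynomial (Fin 3) K) 2).symm
    rw [this, totalDegree_C]
  unfold flexForm
  refine (totalDegree_add _ _).trans (max_le ((totalDegree_sub _ _).trans (max_le ?_ ?_)) ?_)
  · refine (totalDegree_mul _ _).trans ?_
    have := b 2 2
    have := hpow 0
    omega
  · refine (totalDegree_mul _ _).trans ?_
    have h3 := totalDegree_mul (2 * pderiv 2 (pderiv 0 f)) (pderiv 2 f)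
    have h4 := totalDegree_mul 2 (pderiv 2 (pderiv 0 f))
    have := b 2 0
    have := a 0
    have := a 2
    omega
  · refine (totalDegree_mul _ _).trans ?_
    have := b 0 0
    have := hpow 2
    omega

theorem card_filter_common_le [DecidableEq K] {ι : Type*} (I : Finset ι) (α β c : ι → K)
    (hc : Set.InjOn c I)
    (f g : MvPolynomial (Fin 3) K) (hf : Irreducible f) (hfg : ¬ f ∣ g)
    (hI : ∀ i ∈ I, restrA (α i) (β i) (c i) f = 0 ∧ restrA (α i) (β i) (c i) g = 0) :
    I.card ≤ 2 * f.totalDegree * g.totalDegree := by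
  rw [← Finset.card_image_of_injOn hc]
  refine card_common_lines_le f g hf hfg _ ?_
  intro z hz
  obtain ⟨i, hi, rfl⟩ := Finset.mem_image.mp hz
  exact ⟨α i, β i, hI i hi⟩

theorem not_dvd_pderiv_zero [DecidableEq K] (p : ℕ) [CharP K p] {ι : Type*} (I : Finset ι)
    (α β c : ι → K)
    (hc : Set.InjOn c I) (f : MvPolynomial (Fin 3) K) (hf : f ≠ 0) (hdeg : f.totalDegree < p)
    (hI : ∀ i ∈ I, restrA (α i) (β i) (c i) f = 0) (hcard : f.totalDegree < I.card) :
    ¬ f ∣ pderiv 0 f := by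
  intro hdvd
  set P := finSuccEquiv K 2 f with hP
  have hP0 : P ≠ 0 := by simpa [hP] using hf
  have hPd : P.natDegree ≤ f.totalDegree := natDegree_finSuccEquiv_le f
  have hd : P ∣ Polynomial.derivative P := by
    rw [hP, ← finSuccEquiv_pderiv_zero, map_dvd_iff]
    exact hdvd
  have hnat : P.natDegree = 0 := by
    by_contra hne
    have hder : Polynomial.derivative P = 0 := by
      by_contra hne'
      have h1 := Polynomial.natDegree_le_of_dvd hd hne'
      have h2 := Polynomial.natDegree_derivative_lt hne
      omega
    have h3 := congrArg (fun Q => Q.coeff (P.natDegree - 1)) hder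
    simp only [Polynomial.coeff_derivative, Polynomial.coeff_zero] at h3
    rw [Nat.sub_add_cancel (by omega), mul_eq_zero] at h3
    rcases h3 with h3 | h3
    · exact hP0 (Polynomial.leadingCoeff_eq_zero.mp h3)
    · have : ((P.natDegree - 1 : ℕ) : MvPolynomial (Fin 2) K) + 1
          = C ((P.natDegree : ℕ) : K) := by
        have h4 : P.natDegree = (P.natDegree - 1) + 1 := by omega
        conv_rhs => rw [h4]
        simp
      rw [this, C_eq_zero, CharP.cast_eq_zero_iff K p] at h3
      exact absurd (Nat.le_of_dvd (by omega) h3) (by omega)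
  obtain ⟨c₀, hc₀⟩ := Polynomial.natDegree_eq_zero.mp hnat
  have hc₀0 : c₀ ≠ 0 := by
    rintro rfl
    exact hP0 (by rw [← hc₀]; simp)
  have h1 := card_le_totalDegree_of_vanishing c₀ hc₀0 (I.image c) (by
    intro z hz
    obtain ⟨i, hi, rfl⟩ := Finset.mem_image.mp hz
    have h := hI i hi
    have key : restrA (α i) (β i) (c i) f =
      P.eval₂ (aeval ![Polynomial.C (c i), Polynomial.X] :
        MvPolynomial (Fin 2) K →ₐ[K] Polynomial K).toRingHom
        (Polynomial.C (α i) * Polynomial.X + Polynomial.C (β i)) := aeval_cons_eq_eval₂ _ _ f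
    rw [key, ← hc₀] at h
    simpa using h)
  rw [Finset.card_image_of_injOn hc] at h1
  have h2 := totalDegree_coeff_finSuccEquiv_le f 0
  rw [← hP, ← hc₀, Polynomial.coeff_C_zero] at h2
  omega

end restr

section component
variable {K : Type*} [Field K]

theorem exists_irreducible_factor [DecidableEq K] {ι : Type*} (φ : ι → MvPolynomial (Fin 3) K →ₐ[K] Polynomial K)
    (M : ℕ) (F : MvPolynomial (Fin 3) K) (hF : F ≠ 0) (I : Finset ι)
    (hI : ∀ i ∈ I, φ i F = 0) (hcard : M * F.totalDegree < I.card) :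
    ∃ f, Irreducible f ∧ f ∣ F ∧ M * f.totalDegree < (I.filter fun i => φ i f = 0).card := by
  classical
  induction F using WfDvdMonoid.induction_on_irreducible generalizing I with
  | zero => exact absurd rfl hF
  | unit u hu =>
    have : I = ∅ := by
      rw [Finset.eq_empty_iff_forall_notMem]
      intro i hi
      have h1 := hu.map (φ i)
      rw [hI i hi] at h1
      exact not_isUnit_zero h1
    simp [this] at hcard
  | mul F f hF0 hf ih =>
    by_cases hlt : M * f.totalDegree < (I.filter fun i => φ i f = 0).card
    · exact ⟨f, hf, Dvd.intro _ rfl, hlt⟩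
    rw [totalDegree_mul_of_isDomain hf.ne_zero hF0] at hcard
    obtain ⟨g, hg, hgF, hgc⟩ := ih hF0 (I.filter fun i => ¬ φ i f = 0) (by
      intro i hi
      rw [Finset.mem_filter] at hi
      have := hI i hi.1
      rw [map_mul, mul_eq_zero] at this
      exact this.resolve_left hi.2) (by
      have := Finset.card_filter_add_card_filter_not (s := I) (fun i => φ i f = 0)
      rw [mul_add] at hcard
      omega)
    refine ⟨g, hg, hgF.trans (Dvd.intro_left _ rfl), hgc.trans_le (Finset.card_le_card ?_)⟩
    exact Finset.filter_subset_filter _ (Finset.filter_subset _ _)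

/-- The polynomial cutting out, near a line of the second family contained in `f = 0`,
the direction of the ruling lines that meet it. -/
noncomputable def transversalForm (y γ δ : K) (f : MvPolynomial (Fin 3) K) :
    MvPolynomial (Fin 3) K :=
  (C γ⁻¹ * (X 1 - C δ) - X 2) * pderiv 2 f + (C y - X 0) * pderiv 0 f

theorem dvd_transversalForm [Infinite K] (p : ℕ) [CharP K p]
    (f : MvPolynomial (Fin 3) K) (hf : Irreducible f) (hflex : f ∣ flexForm f)
    (hdeg : f.totalDegree < p) {y γ δ : K} (hγ : γ ≠ 0)
    (h0 : restrB y γ δ f = 0) (h1 : restrB y γ δ (pderiv 0 f) ≠ 0) :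
    f ∣ transversalForm y γ δ f := by
  classical
  by_contra hnd
  set g := transversalForm y γ δ f with hg
  set P := restrB y γ δ (pderiv 0 f) with hP
  have hfin : {x | P.IsRoot x}.Finite := Polynomial.finite_setOfPred_isRoot h1
  have hinf : ({x | P.IsRoot x}ᶜ).Infinite := hfin.infinite_compl
  obtain ⟨T, hT, hTc⟩ := hinf.exists_subset_card_eq (2 * f.totalDegree * g.totalDegree + 1)
  have hinj : Function.Injective fun x : K => γ * x + δ := by
    intro a b hab
    simpa [hγ] using hab
  have hle := card_common_lines_le f g hf hnd (T.image fun x => γ * x + δ) (by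
    intro c hc
    obtain ⟨x, hx, rfl⟩ := Finset.mem_image.mp hc
    have hxr : P.eval x ≠ 0 := hT hx
    rw [hP, eval_restrB] at hxr
    have hq : eval ![y, γ * x + δ, x] f = 0 := by rw [← eval_restrB, h0, Polynomial.eval_zero]
    have hrl := ruling_line p f hf hflex hdeg _ hq hxr
    set b := eval ![y, γ * x + δ, x] (pderiv 0 f) with hb
    set a := eval ![y, γ * x + δ, x] (pderiv 2 f) with ha
    simp only [Matrix.cons_val_zero, Matrix.cons_val_one, Matrix.cons_val] at hrl
    refine ⟨_, _, hrl, ?_⟩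
    have hfx := restrA_pderiv_of_eq_zero hrl
    rw [hg, transversalForm]
    simp only [map_add, map_sub, map_mul, hfx]
    have e1 : restrA (-a / b) (y + a / b * x) (γ * x + δ) (C γ⁻¹ : MvPolynomial (Fin 3) K) *
        (restrA (-a / b) (y + a / b * x) (γ * x + δ) (X 1) -
          restrA (-a / b) (y + a / b * x) (γ * x + δ) (C δ)) = Polynomial.C x := by
      simp only [restrA, aeval_X, algHom_C, Matrix.cons_val_one, Matrix.cons_val_zero,
        Polynomial.algebraMap_eq]
      rw [← Polynomial.C_sub, ← Polynomial.C_mul]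
      congr 1
      field_simp
      ring
    have e2 : restrA (-a / b) (y + a / b * x) (γ * x + δ) (X 2) = Polynomial.X := by
      simp [restrA]
    have e0 : restrA (-a / b) (y + a / b * x) (γ * x + δ) (X 0) =
      Polynomial.C (-a / b) * Polynomial.X + Polynomial.C (y + a / b * x) := by
      simp [restrA]
    have e3 : restrA (-a / b) (y + a / b * x) (γ * x + δ) (C y) = Polynomial.C y := by
      simp [restrA]
    rw [e1, e2, e0, e3]
    have hneg : -a / b = -(a / b) := by ring
    rw [hneg]
    simp only [Polynomial.C_add, Polynomial.C_mul, Polynomial.C_neg]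
    ring)
  rw [Finset.card_image_of_injective _ hinj, hTc] at hle
  omega

theorem cross_of_dvd_transversalForm {f : MvPolynomial (Fin 3) K} {α β c y γ δ : K}
    (h : f ∣ transversalForm y γ δ f) (h0 : restrA α β c f = 0)
    (h1 : restrA α β c (pderiv 0 f) ≠ 0) : y = α * (γ⁻¹ * (c - δ)) + β := by
  obtain ⟨w, hw⟩ := h
  have h2 : restrA α β c (transversalForm y γ δ f) = 0 := by rw [hw, map_mul, h0, zero_mul]
  rw [transversalForm] at h2
  simp only [map_add, map_sub, map_mul, restrA_pderiv_of_eq_zero h0] at h2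
  have e1 : restrA α β c (C γ⁻¹ : MvPolynomial (Fin 3) K) = Polynomial.C γ⁻¹ := by simp [restrA]
  have e2 : restrA α β c (X 1 : MvPolynomial (Fin 3) K) = Polynomial.C c := by simp [restrA]
  have e3 : restrA α β c (C δ : MvPolynomial (Fin 3) K) = Polynomial.C δ := by simp [restrA]
  have e4 : restrA α β c (C y : MvPolynomial (Fin 3) K) = Polynomial.C y := by simp [restrA]
  have e5 : restrA α β c (X 2 : MvPolynomial (Fin 3) K) = Polynomial.X := by simp [restrA]
  have e6 : restrA α β c (X 0 : MvPolynomial (Fin 3) K) =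
    Polynomial.C α * Polynomial.X + Polynomial.C β := by simp [restrA]
  rw [e1, e2, e3, e4, e5, e6] at h2
  have h3 : restrA α β c (pderiv 0 f) *
      Polynomial.C (y - (α * (γ⁻¹ * (c - δ)) + β)) = 0 := by
    rw [← h2]
    simp only [Polynomial.C_add, Polynomial.C_mul, Polynomial.C_sub]
    ring
  rw [mul_eq_zero, Polynomial.C_eq_zero] at h3
  exact sub_eq_zero.mp (h3.resolve_left h1)

/-- Few lines of the second family crossing a given line of the first family lie on a surface
that does not contain the given line. -/
theorem card_crossing_contained_le [DecidableEq K] {κ : Type*} (J : Finset κ) (y γ δ : κ → K)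
    (hy : Set.InjOn y J) (α β c : K)
    (hcross : ∀ j ∈ J, ∃ x, y j = α * x + β ∧ c = γ j * x + δ j)
    (h : MvPolynomial (Fin 3) K) (hh : restrA α β c h ≠ 0)
    (hJ : ∀ j ∈ J, restrB (y j) (γ j) (δ j) h = 0) : J.card ≤ h.totalDegree := by
  have hex : ∀ j, ∃ x, j ∈ J → y j = α * x + β ∧ c = γ j * x + δ j := by
    intro j
    by_cases hj : j ∈ J
    · obtain ⟨x, hx⟩ := hcross j hj
      exact ⟨x, fun _ => hx⟩
    · exact ⟨0, fun h => absurd h hj⟩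
  choose x hx using hex
  have hinj : Set.InjOn x J := by
    intro i hi j hj hij
    apply hy hi hj
    rw [(hx i hi).1, (hx j hj).1, hij]
  calc J.card = (J.image x).card := (Finset.card_image_of_injOn hinj).symm
    _ ≤ (restrA α β c h).roots.toFinset.card := by
        refine Finset.card_le_card fun z hz => ?_
        obtain ⟨j, hj, rfl⟩ := Finset.mem_image.mp hz
        rw [Multiset.mem_toFinset, Polynomial.mem_roots hh, Polynomial.IsRoot, eval_restrA]
        have h1 := congrArg (Polynomial.eval (x j)) (hJ j hj)
        rw [eval_restrB, Polynomial.eval_zero] at h1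
        rw [← (hx j hj).1]
        conv_lhs => rw [(hx j hj).2]
        exact h1
    _ ≤ (restrA α β c h).natDegree :=
        (Multiset.toFinset_card_le _).trans (Polynomial.card_roots' _)
    _ ≤ h.totalDegree := natDegree_restrA_le _ _ _ _

theorem no_surface_of_rich_lines [Infinite K] [DecidableEq K] (p : ℕ) [CharP K p] {ι κ : Type*}
    (I : Finset ι) (J : Finset κ) (α β c : ι → K) (y γ δ : κ → K)
    (hc : Set.InjOn c I) (hy : Set.InjOn y J) (hγ : ∀ j ∈ J, γ j ≠ 0)
    (cross : ι → κ → Prop) [∀ i j, Decidable (cross i j)]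
    (hcross : ∀ i ∈ I, ∀ j ∈ J,
      (cross i j ↔ ∃ x, y j = α i * x + β i ∧ c i = γ j * x + δ j))
    (d m k : ℕ) (hdp : d < p) (hm : 2 * d + k < m) (hI : 16 * d ^ 2 < I.card)
    (hrich : ∀ i ∈ I, m ≤ (J.filter fun j => cross i j).card)
    (hk : ∀ i ∈ I, ∀ i' ∈ I, i ≠ i' → (J.filter fun j => cross i j ∧ cross i' j).card ≤ k)
    (F : MvPolynomial (Fin 3) K) (hF : F ≠ 0) (hFd : F.totalDegree ≤ d)
    (hFI : ∀ i ∈ I, restrA (α i) (β i) (c i) F = 0)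
    (hFJ : ∀ j ∈ J, restrB (y j) (γ j) (δ j) F = 0) : False := by
  obtain ⟨f, hf, hfF, hfc⟩ := exists_irreducible_factor
    (fun i => restrA (α i) (β i) (c i)) (16 * d) F hF I hFI (by nlinarith)
  set If := I.filter fun i => restrA (α i) (β i) (c i) f = 0 with hIf
  have hIfI : If ⊆ I := Finset.filter_subset _ _
  have hcf : Set.InjOn c If := hc.mono (by exact_mod_cast hIfI)
  have hfd : f.totalDegree ≤ d := (totalDegree_le_of_dvd_of_isDomain hfF hF).trans hFd
  have hIf0 : ∀ i ∈ If, restrA (α i) (β i) (c i) f = 0 := fun i hi => (Finset.mem_filter.mp hi).2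
  have hd1 : 1 ≤ f.totalDegree := by
    by_contra h
    have h0 : f.totalDegree = 0 := by omega
    rw [totalDegree_eq_zero_iff_eq_C] at h0
    have hne : f.coeff 0 ≠ 0 := by
      intro h1
      rw [h1, C_0] at h0
      exact hf.ne_zero h0
    apply hf.not_isUnit
    rw [h0]
    exact (isUnit_iff_ne_zero.mpr hne).map C
  have hfy : ¬ f ∣ pderiv 0 f :=
    not_dvd_pderiv_zero p If α β c hcf f hf.ne_zero (by omega) hIf0 (by nlinarith)
  have hflex : f ∣ flexForm f := by
    by_contra hnd
    have h1 := card_filter_common_le If α β c hcf f (flexForm f) hf hnd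
      (fun i hi => ⟨hIf0 i hi, restrA_flexForm_of_eq_zero (hIf0 i hi)⟩)
    have h2 := totalDegree_flexForm_le f
    have h3 : 2 * f.totalDegree * (flexForm f).totalDegree
        ≤ 2 * f.totalDegree * (3 * f.totalDegree) := Nat.mul_le_mul_left _ h2
    nlinarith
  obtain ⟨G, hFG, hG⟩ :=
    (FiniteMultiplicity.of_not_isUnit hf.not_isUnit hF).exists_eq_pow_mul_and_not_dvd
  set e := multiplicity f F
  have hG0 : G ≠ 0 := by
    rintro rfl
    exact hG (dvd_zero f)
  have hGd : G.totalDegree ≤ d :=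
    (totalDegree_le_of_dvd_of_isDomain ⟨f ^ e, by rw [hFG]; ring⟩ hF).trans hFd
  have hyd : (pderiv 0 f).totalDegree ≤ f.totalDegree := totalDegree_pderiv_le 0 f
  set good := (If.filter fun i => ¬ restrA (α i) (β i) (c i) G = 0).filter
    fun i => ¬ restrA (α i) (β i) (c i) (pderiv 0 f) = 0 with hgood
  have hb1 : (If.filter fun i => restrA (α i) (β i) (c i) G = 0).card
      ≤ 2 * f.totalDegree * d := by
    refine (card_filter_common_le _ α β c
      (hcf.mono (by exact_mod_cast Finset.filter_subset _ _)) f G hf hG ?_).trans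
      (Nat.mul_le_mul_left _ hGd)
    intro i hi
    rw [Finset.mem_filter] at hi
    exact ⟨hIf0 i hi.1, hi.2⟩
  have hb2 : ((If.filter fun i => ¬ restrA (α i) (β i) (c i) G = 0).filter
      fun i => restrA (α i) (β i) (c i) (pderiv 0 f) = 0).card ≤ 2 * f.totalDegree * d := by
    refine (card_filter_common_le _ α β c
      (hcf.mono (by
        exact_mod_cast (Finset.filter_subset _ _).trans (Finset.filter_subset _ _))) f _ hf hfy
        ?_).trans
      (Nat.mul_le_mul_left _ (hyd.trans hfd))
    intro i hi
    rw [Finset.mem_filter, Finset.mem_filter] at hi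
    exact ⟨hIf0 i hi.1.1, hi.2⟩
  have hgc : 1 < good.card := by
    have e1 := Finset.card_filter_add_card_filter_not (s := If)
      (fun i => restrA (α i) (β i) (c i) G = 0)
    have e2 := Finset.card_filter_add_card_filter_not
      (s := If.filter fun i => ¬ restrA (α i) (β i) (c i) G = 0)
      (fun i => restrA (α i) (β i) (c i) (pderiv 0 f) = 0)
    have e3 : 1 ≤ d * f.totalDegree := Nat.mul_pos (by omega) hd1
    nlinarith
  obtain ⟨i0, hi0, i1, hi1, hne⟩ := Finset.one_lt_card.mp hgc
  have hmem : ∀ i ∈ good, i ∈ I ∧ restrA (α i) (β i) (c i) f = 0 ∧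
      restrA (α i) (β i) (c i) G ≠ 0 ∧ restrA (α i) (β i) (c i) (pderiv 0 f) ≠ 0 := by
    intro i hi
    rw [hgood, Finset.mem_filter, Finset.mem_filter] at hi
    exact ⟨hIfI hi.1.1, hIf0 i hi.1.1, hi.1.2, hi.2⟩
  obtain ⟨hi0I, hi0f, hi0G, hi0y⟩ := hmem i0 hi0
  obtain ⟨hi1I, hi1f, hi1G, hi1y⟩ := hmem i1 hi1
  set J0 := J.filter fun j => cross i0 j with hJ0
  have hJ0J : ∀ j ∈ J0, j ∈ J ∧ ∃ x, y j = α i0 * x + β i0 ∧ c i0 = γ j * x + δ j := by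
    intro j hj
    rw [hJ0, Finset.mem_filter] at hj
    exact ⟨hj.1, (hcross i0 hi0I j hj.1).mp hj.2⟩
  have hbad : ∀ h : MvPolynomial (Fin 3) K, restrA (α i0) (β i0) (c i0) h ≠ 0 →
      ∀ S ⊆ J0, (∀ j ∈ S, restrB (y j) (γ j) (δ j) h = 0) → S.card ≤ h.totalDegree := by
    intro h hh S hS hS0
    refine card_crossing_contained_le S y γ δ ?_ (α i0) (β i0) (c i0) ?_ h hh hS0
    · intro a ha b hb
      exact hy (hJ0J a (hS ha)).1 (hJ0J b (hS hb)).1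
    · intro j hj
      exact (hJ0J j (hS hj)).2
  have hB1 := (hbad G hi0G (J0.filter fun j => ¬ restrB (y j) (γ j) (δ j) f = 0)
    (Finset.filter_subset _ _) (by
      intro j hj
      rw [Finset.mem_filter] at hj
      have := hFJ j (hJ0J j hj.1).1
      rw [hFG, map_mul, map_pow, mul_eq_zero] at this
      exact this.resolve_left (pow_ne_zero _ hj.2))).trans hGd
  have hB2 := (hbad (pderiv 0 f) hi0y ((J0.filter fun j => restrB (y j) (γ j) (δ j) f = 0).filter
      fun j => restrB (y j) (γ j) (δ j) (pderiv 0 f) = 0)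
    ((Finset.filter_subset _ _).trans (Finset.filter_subset _ _)) (by
      intro j hj
      exact (Finset.mem_filter.mp hj).2)).trans (hyd.trans hfd)
  have e1 := Finset.card_filter_add_card_filter_not (s := J0)
      (fun j => restrB (y j) (γ j) (δ j) f = 0)
  have e2 := Finset.card_filter_add_card_filter_not
      (s := J0.filter fun j => restrB (y j) (γ j) (δ j) f = 0)
      (fun j => restrB (y j) (γ j) (δ j) (pderiv 0 f) = 0)
  have hsub : ((J0.filter fun j => restrB (y j) (γ j) (δ j) f = 0).filter
      fun j => ¬ restrB (y j) (γ j) (δ j) (pderiv 0 f) = 0) ⊆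
      J.filter fun j => cross i0 j ∧ cross i1 j := by
    intro j hj
    rw [Finset.mem_filter, Finset.mem_filter, hJ0, Finset.mem_filter] at hj
    obtain ⟨⟨⟨hjJ, hj0⟩, hjf⟩, hjy⟩ := hj
    rw [Finset.mem_filter]
    refine ⟨hjJ, hj0, (hcross i1 hi1I j hjJ).mpr ⟨(γ j)⁻¹ * (c i1 - δ j), ?_, ?_⟩⟩
    · exact cross_of_dvd_transversalForm
        (dvd_transversalForm p f hf hflex (by omega) (hγ j hjJ) hjf hjy) hi1f hi1y
    · rw [← mul_assoc, mul_inv_cancel₀ (hγ j hjJ)]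
      ring
  have h3 := (Finset.card_le_card hsub).trans (hk i0 hi0I i1 hi1I hne)
  have h4 : m ≤ J0.card := hrich i0 hi0I
  omega

end component

section bipartite
variable {ι κ : Type*} [DecidableEq ι] [DecidableEq κ] (cross : ι → κ → Prop)
  [∀ i j, Decidable (cross i j)]

/-- A bipartite graph with many edges has a nonempty subgraph of large minimum degree. -/
theorem exists_large_min_degree (I : Finset ι) (J : Finset κ) (m : ℕ)
    (hE : m * (I.card + J.card) < ∑ i ∈ I, (J.filter fun j => cross i j).card) :
    ∃ I' ⊆ I, ∃ J' ⊆ J, I'.Nonempty ∧ J'.Nonempty ∧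
      (∀ i ∈ I', m ≤ (J'.filter fun j => cross i j).card) ∧
      (∀ j ∈ J', m ≤ (I'.filter fun i => cross i j).card) := by
  have hcomm : ∀ (A : Finset ι) (B : Finset κ), ∑ i ∈ A, (B.filter fun j => cross i j).card =
      ∑ j ∈ B, (A.filter fun i => cross i j).card := fun A B =>
    Finset.sum_card_bipartiteAbove_eq_sum_card_bipartiteBelow cross
  obtain ⟨⟨A, B⟩, hAB, hmax⟩ := Finset.exists_max_image (I.powerset ×ˢ J.powerset)
    (fun P => ((∑ i ∈ P.1, (P.2.filter fun j => cross i j).card : ℕ) : ℤ)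
      - m * (P.1.card + P.2.card)) ⟨(I, J), by simp⟩
  rw [Finset.mem_product, Finset.mem_powerset, Finset.mem_powerset] at hAB
  dsimp only at hAB hmax
  have hpos : (0 : ℤ) < ((∑ i ∈ A, (B.filter fun j => cross i j).card : ℕ) : ℤ)
      - m * (A.card + B.card) := by
    refine lt_of_lt_of_le ?_ (hmax (I, J) (by simp))
    have : ((m * (I.card + J.card) : ℕ) : ℤ) <
      ((∑ i ∈ I, (J.filter fun j => cross i j).card : ℕ) : ℤ) := by exact_mod_cast hE
    push_cast at this ⊢
    linarith
  have hmpos : (0 : ℤ) ≤ m * (A.card + B.card) := by positivity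
  refine ⟨A, hAB.1, B, hAB.2, ?_, ?_, ?_, ?_⟩
  · rw [Finset.nonempty_iff_ne_empty]
    rintro rfl
    simp at hpos
    linarith [mul_nonneg (Int.natCast_nonneg m) (Int.natCast_nonneg B.card)]
  · rw [Finset.nonempty_iff_ne_empty]
    rintro rfl
    simp at hpos
    linarith [mul_nonneg (Int.natCast_nonneg m) (Int.natCast_nonneg A.card)]
  · intro i hi
    have h1 := hmax (A.erase i, B) (by
      simp only [Finset.mem_product, Finset.mem_powerset]
      exact ⟨(Finset.erase_subset _ _).trans hAB.1, hAB.2⟩)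
    dsimp only at h1
    rw [← Finset.add_sum_erase A _ hi, ← Finset.card_erase_add_one hi] at h1
    push_cast at h1
    have : (m : ℤ) ≤ (B.filter fun j => cross i j).card := by linarith
    exact_mod_cast this
  · intro j hj
    have h1 := hmax (A, B.erase j) (by
      simp only [Finset.mem_product, Finset.mem_powerset]
      exact ⟨hAB.1, (Finset.erase_subset _ _).trans hAB.2⟩)
    dsimp only at h1
    rw [hcomm, hcomm, ← Finset.add_sum_erase B _ hj, ← Finset.card_erase_add_one hj] at h1
    push_cast at h1
    have : (m : ℤ) ≤ (A.filter fun i => cross i j).card := by linarith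
    exact_mod_cast this

/-- Weight of a vertex with `h` chosen neighbours, in the greedy selection. -/
noncomputable def hitWeight (d h : ℕ) : ℝ := if h ≤ d then (1 / 2 : ℝ) ^ h else 0

theorem hitWeight_nonneg (d h : ℕ) : 0 ≤ hitWeight d h := by
  unfold hitWeight; split_ifs <;> positivity

theorem hitWeight_succ_le (d h : ℕ) : hitWeight d (h + 1) ≤ hitWeight d h / 2 := by
  unfold hitWeight
  split_ifs with h1 h2
  · rw [pow_succ]; linarith
  · omega
  · positivity
  · simp

theorem exists_hitting_set (I : Finset ι) (J : Finset κ) (d m : ℕ) (hI : I.Nonempty)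
    (hm : 2 * (d + 1) ≤ m) (hdeg : ∀ j ∈ J, m ≤ (I.filter fun i => cross i j).card) (s : ℕ) :
    ∃ S ⊆ I, S.card ≤ s ∧
      ∑ j ∈ J, hitWeight d (S.filter fun i => cross i j).card ≤
        J.card * (1 - m / (4 * I.card) : ℝ) ^ s := by
  have hI0 : (0 : ℝ) < I.card := by exact_mod_cast hI.card_pos
  by_cases hJ : J = ∅
  · exact ⟨∅, by simp, by simp, by simp [hJ]⟩
  obtain ⟨j0, hj0⟩ := Finset.nonempty_iff_ne_empty.mpr hJ
  have hmI : (m : ℝ) ≤ I.card := by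
    exact_mod_cast (hdeg j0 hj0).trans (Finset.card_filter_le _ _)
  have hfac : (0 : ℝ) ≤ 1 - m / (4 * I.card) := by
    rw [sub_nonneg, div_le_one (by positivity)]
    linarith
  induction s with
  | zero =>
    refine ⟨∅, by simp, by simp, ?_⟩
    simp [hitWeight]
  | succ s ih =>
    obtain ⟨S, hSI, hSc, hS⟩ := ih
    set h : κ → ℕ := fun j => (S.filter fun i => cross i j).card with hh
    set W := ∑ j ∈ J, hitWeight d (h j) with hW
    have hstep : ∀ j ∈ J, ∑ i ∈ I, hitWeight d ((insert i S).filter fun i => cross i j).card ≤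
        (I.card - m / 4 : ℝ) * hitWeight d (h j) := by
      intro j hj
      by_cases hjd : h j ≤ d
      · have hins : ∀ i, hitWeight d ((insert i S).filter fun i => cross i j).card ≤
            hitWeight d (h j) - if cross i j ∧ i ∉ S then hitWeight d (h j) / 2 else 0 := by
          intro i
          rw [Finset.filter_insert]
          by_cases hc : cross i j
          · by_cases hiS : i ∈ S
            · rw [if_pos hc, if_neg (by simp [hiS]), sub_zero, Finset.insert_eq_of_mem
                (Finset.mem_filter.mpr ⟨hiS, hc⟩)]
            · rw [if_pos hc, if_pos ⟨hc, hiS⟩, Finset.card_insert_of_notMem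
                (fun hmem => hiS (Finset.mem_filter.mp hmem).1)]
              have := hitWeight_succ_le d (h j)
              linarith
          · rw [if_neg hc, if_neg (by simp [hc]), sub_zero]
        have hcount : (m : ℝ) / 2 ≤ (I.filter fun i => cross i j ∧ i ∉ S).card := by
          have h1 : (I.filter fun i => cross i j) ⊆
              (I.filter fun i => cross i j ∧ i ∉ S) ∪ (S.filter fun i => cross i j) := by
            intro i hi
            rw [Finset.mem_filter] at hi
            rw [Finset.mem_union, Finset.mem_filter, Finset.mem_filter]
            tauto
          have h2 := (hdeg j hj).trans ((Finset.card_le_card h1).trans (Finset.card_union_le _ _))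
          have h3 : m ≤ 2 * (I.filter fun i => cross i j ∧ i ∉ S).card := by
            change m ≤ _ + h j at h2
            omega
          have : (m : ℝ) ≤ 2 * (I.filter fun i => cross i j ∧ i ∉ S).card := by exact_mod_cast h3
          linarith
        calc _ ≤ ∑ i ∈ I, (hitWeight d (h j) -
              if cross i j ∧ i ∉ S then hitWeight d (h j) / 2 else 0) :=
              Finset.sum_le_sum fun i _ => hins i
          _ = I.card * hitWeight d (h j) -
              (I.filter fun i => cross i j ∧ i ∉ S).card * (hitWeight d (h j) / 2) := by
              rw [Finset.sum_sub_distrib, Finset.sum_const, nsmul_eq_mul, ← Finset.sum_filter,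
                Finset.sum_const, nsmul_eq_mul]
          _ ≤ _ := by nlinarith [hitWeight_nonneg d (h j)]
      · have hz : hitWeight d (h j) = 0 := by simp [hitWeight, hjd]
        rw [hz, mul_zero]
        refine (Finset.sum_eq_zero fun i _ => ?_).le
        have : ¬ ((insert i S).filter fun i => cross i j).card ≤ d := by
          intro hle
          apply hjd
          exact (Finset.card_le_card (Finset.filter_subset_filter _
            (Finset.subset_insert _ _))).trans hle
        simp [hitWeight, this]
    have htot : ∑ i ∈ I, ∑ j ∈ J, hitWeight d ((insert i S).filter fun i => cross i j).card ≤
        ∑ i ∈ I, (1 - m / (4 * I.card) : ℝ) * W := by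
      rw [Finset.sum_comm, Finset.sum_const, nsmul_eq_mul]
      refine (Finset.sum_le_sum hstep).trans ?_
      rw [← Finset.mul_sum, ← hW, ← mul_assoc]
      refine le_of_eq ?_
      congr 1
      field_simp
    obtain ⟨i, hi, hle⟩ := Finset.exists_le_of_sum_le hI htot
    refine ⟨insert i S, Finset.insert_subset hi hSI, (Finset.card_insert_le _ _).trans (by omega),
      hle.trans ?_⟩
    rw [pow_succ]
    calc _ ≤ (1 - m / (4 * I.card) : ℝ) * (J.card * (1 - m / (4 * I.card) : ℝ) ^ s) :=
          mul_le_mul_of_nonneg_left hS hfac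
      _ = _ := by ring

end bipartite

theorem exists_vanishing_poly {K : Type*} [Field K] {ι : Type*} (S : Finset ι)
    (α β c : ι → K) (n : ℕ) (h : S.card * (3 * n + 1) < (n + 1) ^ 3) :
    ∃ F : MvPolynomial (Fin 3) K, F ≠ 0 ∧ F.totalDegree ≤ 3 * n ∧
      ∀ i ∈ S, restrA (α i) (β i) (c i) F = 0 := by
  classical
  let V := (Fin 3 → Fin (n + 1)) → K
  let ex : (Fin 3 → Fin (n + 1)) → (Fin 3 →₀ ℕ) := fun u =>
    Finsupp.equivFunOnFinite.symm fun i => (u i : ℕ)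
  have hex : Function.Injective ex := by
    intro u v huv
    funext i
    have := congrArg (fun w => w i) huv
    exact Fin.ext (by simpa [ex] using this)
  let poly : V →ₗ[K] MvPolynomial (Fin 3) K :=
    ∑ u, (monomial (ex u)) ∘ₗ (LinearMap.proj u)
  have hpoly : ∀ a, poly a = ∑ u, monomial (ex u) (a u) := by
    intro a
    simp [poly]
    rfl
  have hdeg : ∀ a, (poly a).totalDegree ≤ 3 * n := by
    intro a
    rw [hpoly]
    refine totalDegree_finsetSum_le fun u _ => (totalDegree_monomial_le _ _).trans ?_
    rw [Finsupp.sum_fintype _ _ (fun _ => rfl)]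
    calc _ ≤ ∑ i : Fin 3, n := Finset.sum_le_sum fun i _ => by
          simp only [ex, Finsupp.equivFunOnFinite_symm_apply_apply]
          exact Nat.lt_succ_iff.mp (u i).2
      _ = 3 * n := by simp
  let T : V →ₗ[K] (S × Fin (3 * n + 1) → K) :=
    LinearMap.pi fun q => (Polynomial.lcoeff K q.2) ∘ₗ
      ((restrA (α q.1) (β q.1) (c q.1)).toLinearMap ∘ₗ poly)
  have hker : LinearMap.ker T ≠ ⊥ := by
    apply LinearMap.ker_ne_bot_of_finrank_lt
    simp only [V, Module.finrank_fintype_fun_eq_card, Fintype.card_prod, Fintype.card_coe,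
      Fintype.card_fin, Fintype.card_fun]
    exact h
  obtain ⟨a, ha, ha0⟩ := (Submodule.ne_bot_iff _).mp hker
  refine ⟨poly a, ?_, hdeg a, ?_⟩
  · intro h0
    apply ha0
    funext u
    have := congrArg (coeff (ex u)) h0
    rw [hpoly, coeff_sum, coeff_zero, Finset.sum_eq_single u] at this
    · simpa using! this
    · intro v _ hv
      rw [coeff_monomial, if_neg]
      exact fun hh => hv (hex hh)
    · simp
  · intro i hi
    ext k
    rw [Polynomial.coeff_zero]
    by_cases hk : k < 3 * n + 1
    · exact congrFun (LinearMap.mem_ker.mp ha) (⟨i, hi⟩, ⟨k, hk⟩)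
    · apply Polynomial.coeff_eq_zero_of_natDegree_lt
      have := natDegree_restrA_le (α i) (β i) (c i) (poly a)
      have := hdeg a
      omega

section incidence
variable {K : Type*} [Field K]

/-- Few lines of the first family crossing a given line of the second family lie on a surface
that does not contain the given line. -/
theorem card_crossing_contained_le' [DecidableEq K] {ι : Type*} (I : Finset ι) (α β c : ι → K)
    (hc : Set.InjOn c I) (y γ δ : K)
    (hcross : ∀ i ∈ I, ∃ x, y = α i * x + β i ∧ c i = γ * x + δ)
    (h : MvPolynomial (Fin 3) K) (hh : restrB y γ δ h ≠ 0)
    (hI : ∀ i ∈ I, restrA (α i) (β i) (c i) h = 0) : I.card ≤ h.totalDegree := by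
  have hex : ∀ i, ∃ x, i ∈ I → y = α i * x + β i ∧ c i = γ * x + δ := by
    intro i
    by_cases hi : i ∈ I
    · obtain ⟨x, hx⟩ := hcross i hi
      exact ⟨x, fun _ => hx⟩
    · exact ⟨0, fun h => absurd h hi⟩
  choose x hx using hex
  have hinj : Set.InjOn x I := by
    intro i hi j hj hij
    apply hc hi hj
    rw [(hx i hi).2, (hx j hj).2, hij]
  calc I.card = (I.image x).card := (Finset.card_image_of_injOn hinj).symm
    _ ≤ (restrB y γ δ h).roots.toFinset.card := by
        refine Finset.card_le_card fun z hz => ?_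
        obtain ⟨i, hi, rfl⟩ := Finset.mem_image.mp hz
        rw [Multiset.mem_toFinset, Polynomial.mem_roots hh, Polynomial.IsRoot, eval_restrB]
        have h1 := congrArg (Polynomial.eval (x i)) (hI i hi)
        rw [eval_restrA, Polynomial.eval_zero] at h1
        rw [← (hx i hi).2]
        conv_lhs => rw [(hx i hi).1]
        exact h1
    _ ≤ (restrB y γ δ h).natDegree :=
        (Multiset.toFinset_card_le _).trans (Polynomial.card_roots' _)
    _ ≤ h.totalDegree := natDegree_restrB_le _ _ _ _

theorem sqrt_div_bounds (n r : ℕ) (hr : 1 ≤ r) (h1 : 10000 * r ≤ n) (hnr : n < r ^ 2) :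
    n < 169 * (Nat.sqrt n / 13 + 1) ^ 2 ∧ 16 * (3 * (Nat.sqrt n / 13)) ^ 2 < n ∧
      13 * (Nat.sqrt n / 13) < r := by
  have hsq1 : Nat.sqrt n * Nat.sqrt n ≤ n := Nat.sqrt_le _
  have hsq2 : n < (Nat.sqrt n + 1) * (Nat.sqrt n + 1) := Nat.lt_succ_sqrt _
  have hsr : Nat.sqrt n < r := by
    by_contra h
    push Not at h
    have := Nat.mul_le_mul h h
    rw [pow_two] at hnr
    omega
  generalize Nat.sqrt n = q at *
  obtain ⟨a, ha⟩ : ∃ a, q / 13 = a := ⟨_, rfl⟩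
  have ha1 : 13 * a ≤ q := by omega
  have ha2 : q + 1 ≤ 13 * (a + 1) := by omega
  rw [ha]
  refine ⟨?_, ?_, by omega⟩
  · have := Nat.mul_le_mul ha2 ha2
    nlinarith
  · have := Nat.mul_le_mul ha1 ha1
    rcases Nat.eq_zero_or_pos a with h0 | h0
    · rw [h0]; simp; omega
    · nlinarith

theorem hitting_weight_lt (n m r σ a : ℕ) (hr : 1 ≤ r) (hn : 10000 * r ≤ n) (hm : m < r ^ 2)
    (hσ : n ≤ 676 * σ) (ha : 3 * a ≤ r) :
    (m : ℝ) * (1 - ((10000 * r : ℕ) : ℝ) / (4 * n)) ^ σ < (1 / 2 : ℝ) ^ (3 * a) := by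
  have hnpos : (0 : ℝ) < n := by
    have : 0 < n := by omega
    exact_mod_cast this
  set x : ℝ := ((10000 * r : ℕ) : ℝ) / (4 * n) with hx
  have hx1 : x ≤ 1 := by
    rw [hx, div_le_one (by positivity)]
    have : ((10000 * r : ℕ) : ℝ) ≤ n := by exact_mod_cast hn
    linarith
  have h1 : (1 - x) ^ σ ≤ Real.exp (-(3 * r)) := by
    have h2 : (1 - x) ^ σ ≤ Real.exp (-x) ^ σ :=
      pow_le_pow_left₀ (by linarith) (Real.one_sub_le_exp_neg x) σ
    rw [← Real.exp_nat_mul] at h2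
    refine h2.trans (Real.exp_le_exp.mpr ?_)
    have h3 : (n : ℝ) ≤ 676 * σ := by exact_mod_cast hσ
    have h4 : 3 * (r : ℝ) ≤ σ * x := by
      have h5 : ((10000 * r : ℕ) : ℝ) = 10000 * r := by push_cast; ring
      rw [hx, h5, mul_div_assoc', le_div_iff₀ (by positivity)]
      have hr0 : (0 : ℝ) ≤ r := Nat.cast_nonneg r
      have h6 : (0 : ℝ) ≤ r * (676 * σ - n) := mul_nonneg hr0 (by linarith)
      have h7 : (0 : ℝ) ≤ r * σ := by positivity
      linarith
    linarith
  have h5 : (m : ℝ) < Real.exp (2 * r) := by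
    have h6 : (m : ℝ) < (r : ℝ) ^ 2 := by exact_mod_cast hm
    have h7 : (r : ℝ) ≤ Real.exp r := by linarith [Real.add_one_le_exp (r : ℝ)]
    have h8 : (r : ℝ) ^ 2 ≤ Real.exp r ^ 2 := pow_le_pow_left₀ (by positivity) h7 2
    rw [← Real.exp_nat_mul] at h8
    push_cast at h8
    linarith
  have h9 : Real.exp (-(r : ℝ)) ≤ (1 / 2 : ℝ) ^ (3 * a) := by
    have h10 : Real.exp (-1) ≤ 1 / 2 := by
      rw [Real.exp_neg, one_div]
      exact inv_anti₀ (by norm_num) (by linarith [Real.add_one_le_exp (1 : ℝ)])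
    have h11 : Real.exp (-(r : ℝ)) = Real.exp (-1) ^ r := by
      rw [← Real.exp_nat_mul]; congr 1; ring
    rw [h11]
    calc Real.exp (-1) ^ r ≤ (1 / 2 : ℝ) ^ r := pow_le_pow_left₀ (Real.exp_nonneg _) h10 r
      _ ≤ (1 / 2 : ℝ) ^ (3 * a) := pow_le_pow_of_le_one (by norm_num) (by norm_num) ha
  calc (m : ℝ) * (1 - x) ^ σ ≤ m * Real.exp (-(3 * r)) :=
        mul_le_mul_of_nonneg_left h1 (by positivity)
    _ < Real.exp (2 * r) * Real.exp (-(3 * r)) :=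
        mul_lt_mul_of_pos_right h5 (Real.exp_pos _)
    _ = Real.exp (-(r : ℝ)) := by rw [← Real.exp_add]; congr 1; ring
    _ ≤ _ := h9

theorem no_rich_configuration [Infinite K] [DecidableEq K] (p : ℕ) [CharP K p] {ι κ : Type*}
    [DecidableEq ι] [DecidableEq κ]
    (I : Finset ι) (J : Finset κ) (α β c : ι → K) (y γ δ : κ → K)
    (hc : Set.InjOn c I) (hy : Set.InjOn y J) (hγ : ∀ j ∈ J, γ j ≠ 0)
    (cross : ι → κ → Prop) [∀ i j, Decidable (cross i j)]
    (hcross : ∀ i ∈ I, ∀ j ∈ J,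
      (cross i j ↔ ∃ x, y j = α i * x + β i ∧ c i = γ j * x + δ j))
    (r k : ℕ) (hr : 1 ≤ r) (hrp : r ≤ p + 1) (hkr : k ≤ r)
    (hIr : I.card < r ^ 2) (hJr : J.card < r ^ 2) (hJ : J.Nonempty) (hI : I.Nonempty)
    (hrich : ∀ i ∈ I, 10000 * r ≤ (J.filter fun j => cross i j).card)
    (hrich' : ∀ j ∈ J, 10000 * r ≤ (I.filter fun i => cross i j).card)
    (hk : ∀ i ∈ I, ∀ i' ∈ I, i ≠ i' → (J.filter fun j => cross i j ∧ cross i' j).card ≤ k) :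
    False := by
  obtain ⟨j0, hj0⟩ := hJ
  have hI1 : 10000 * r ≤ I.card := (hrich' j0 hj0).trans (Finset.card_filter_le _ _)
  obtain ⟨h169, h144, har⟩ := sqrt_div_bounds I.card r hr hI1 hIr
  generalize Nat.sqrt I.card / 13 = a at h169 h144 har
  obtain ⟨σ, hσ1, hσ2⟩ : ∃ σ, 3 * σ ≤ (a + 1) ^ 2 ∧ (a + 1) ^ 2 ≤ 4 * σ :=
    ⟨(a + 1) ^ 2 / 3, by omega, by omega⟩
  obtain ⟨S, hSI, hSc, hS⟩ := exists_hitting_set cross I J (3 * a) (10000 * r) hI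
    (by omega) hrich' σ
  obtain ⟨F, hF, hFd, hFS⟩ := exists_vanishing_poly S α β c a (by
    have : S.card * (3 * a + 1) ≤ σ * (3 * a + 1) := Nat.mul_le_mul_right _ hSc
    nlinarith [Nat.zero_le a, pow_pos (Nat.succ_pos a) 2])
  have hsmall : ∑ j ∈ J, hitWeight (3 * a) (S.filter fun i => cross i j).card
      < (1 / 2 : ℝ) ^ (3 * a) :=
    hS.trans_lt (hitting_weight_lt _ _ r σ a hr hI1 hJr (by omega) (by omega))
  have hhit : ∀ j ∈ J, 3 * a < (S.filter fun i => cross i j).card := by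
    intro j hj
    by_contra hle
    push Not at hle
    have h1 := Finset.single_le_sum (f := fun j =>
      hitWeight (3 * a) (S.filter fun i => cross i j).card)
      (fun j _ => hitWeight_nonneg _ _) hj
    have h2 : (1 / 2 : ℝ) ^ (3 * a) ≤ hitWeight (3 * a) (S.filter fun i => cross i j).card := by
      rw [hitWeight, if_pos hle]
      exact pow_le_pow_of_le_one (by norm_num) (by norm_num) hle
    linarith
  have hFJ : ∀ j ∈ J, restrB (y j) (γ j) (δ j) F = 0 := by
    intro j hj
    by_contra hne
    have := card_crossing_contained_le' (S.filter fun i => cross i j) α β c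
      (hc.mono (by exact_mod_cast (Finset.filter_subset _ _).trans hSI)) (y j) (γ j) (δ j)
      (by
        intro i hi
        rw [Finset.mem_filter] at hi
        exact (hcross i (hSI hi.1) j hj).mp hi.2) F hne
      (fun i hi => hFS i (Finset.mem_filter.mp hi).1)
    have := hhit j hj
    omega
  have hFI : ∀ i ∈ I, restrA (α i) (β i) (c i) F = 0 := by
    intro i hi
    by_contra hne
    have := card_crossing_contained_le (J.filter fun j => cross i j) y γ δ
      (hy.mono (by exact_mod_cast Finset.filter_subset _ _)) (α i) (β i) (c i)
      (by
        intro j hj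
        rw [Finset.mem_filter] at hj
        exact (hcross i hi j hj.1).mp hj.2) F hne
      (fun j hj => hFJ j (Finset.mem_filter.mp hj).1)
    have := hrich i hi
    omega
  have hr2 : 1 < r := by
    by_contra h
    have : r = 1 := by omega
    subst this
    omega
  exact no_surface_of_rich_lines p I J α β c y γ δ hc hy hγ cross hcross (3 * a) (10000 * r) k
    (by omega) (by omega) h144 hrich hk F hF hFd hFI hFJ

/-- Incidence bound for two families of skew lines in three-space. -/
theorem card_crossings_le [Infinite K] [DecidableEq K] (p : ℕ) [CharP K p] {ι κ : Type*}
    [DecidableEq ι] [DecidableEq κ]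
    (I : Finset ι) (J : Finset κ) (α β c : ι → K) (y γ δ : κ → K)
    (hc : Set.InjOn c I) (hy : Set.InjOn y J) (hγ : ∀ j ∈ J, γ j ≠ 0)
    (cross : ι → κ → Prop) [∀ i j, Decidable (cross i j)]
    (hcross : ∀ i ∈ I, ∀ j ∈ J,
      (cross i j ↔ ∃ x, y j = α i * x + β i ∧ c i = γ j * x + δ j))
    (N k : ℕ) (hNp : N ≤ p ^ 2) (hkN : k ^ 2 ≤ N) (hIN : I.card ≤ N) (hJN : J.card ≤ N)
    (hk : ∀ i ∈ I, ∀ i' ∈ I, i ≠ i' → (J.filter fun j => cross i j ∧ cross i' j).card ≤ k) :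
    ((∑ i ∈ I, (J.filter fun j => cross i j).card : ℕ) : ℝ) ≤ 40000 * N * √N := by
  rcases Nat.eq_zero_or_pos N with h0 | hN
  · have : I = ∅ := by
      rw [← Finset.card_eq_zero]; omega
    simp [this, h0]
  by_contra hlt
  push Not at hlt
  set r := Nat.sqrt N + 1 with hr
  have hs1 : 1 ≤ Nat.sqrt N := Nat.sqrt_pos.mpr hN
  have hr2 : (r : ℝ) ≤ 2 * √N := by
    have h1 : (Nat.sqrt N : ℝ) ≤ √N := Real.nat_sqrt_le_real_sqrt
    have h2 : (1 : ℝ) ≤ Nat.sqrt N := by exact_mod_cast hs1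
    rw [hr]; push_cast; linarith
  have hNr : N < r ^ 2 := by rw [pow_two]; exact Nat.lt_succ_sqrt _
  obtain ⟨I', hI', J', hJ', hIne, hJne, h1, h2⟩ := exists_large_min_degree cross I J (10000 * r) (by
    have h3 : ((10000 * r * (I.card + J.card) : ℕ) : ℝ) ≤ 40000 * N * √N := by
      push_cast
      have h4 : (I.card : ℝ) ≤ N := by exact_mod_cast hIN
      have h5 : (J.card : ℝ) ≤ N := by exact_mod_cast hJN
      have h6 : (0 : ℝ) ≤ r := by positivity
      have h7 : (0 : ℝ) ≤ N := by positivity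
      calc 10000 * (r : ℝ) * (I.card + J.card) ≤ 10000 * r * (N + N) := by gcongr
        _ ≤ 10000 * (2 * √N) * (N + N) := by gcongr
        _ = _ := by ring
    exact_mod_cast h3.trans_lt hlt)
  have hsp : Nat.sqrt N ≤ p := by
    calc Nat.sqrt N ≤ Nat.sqrt (p ^ 2) := Nat.sqrt_le_sqrt hNp
      _ = p := Nat.sqrt_eq' p
  refine no_rich_configuration p I' J' α β c y γ δ (hc.mono (by exact_mod_cast hI'))
    (hy.mono (by exact_mod_cast hJ')) (fun j hj => hγ j (hJ' hj)) cross
    (fun i hi j hj => hcross i (hI' hi) j (hJ' hj)) r k (by omega) (by omega) ?_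
    ((Finset.card_le_card hI').trans_lt (hIN.trans_lt hNr))
    ((Finset.card_le_card hJ').trans_lt (hJN.trans_lt hNr)) hJne hIne h1 h2 ?_
  · have : k ≤ Nat.sqrt N := Nat.le_sqrt'.mpr hkN
    omega
  · intro i hi i' hi' hne
    exact (Finset.card_le_card (Finset.filter_subset_filter _ hJ')).trans
      (hk i (hI' hi) i' (hI' hi') hne)

end incidence

end SkewLines

namespace SkewLines

theorem sum_rsub_sq {G : Type*} [AddCommGroup G] [DecidableEq G] [Fintype G] (D : Finset G) :
    ∑ x : G, rsub D x ^ 2 =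
      ∑ a ∈ D, ∑ b ∈ D, ∑ e ∈ D, ∑ f ∈ D, if a + b = e + f then 1 else 0 := by
  have h1 : ∀ x, rsub D x = ∑ a ∈ D, ∑ e ∈ D, if a - e = x then 1 else 0 := by
    intro x
    rw [rsub, Finset.card_filter, Finset.sum_product]
  simp_rw [pow_two, h1, Finset.sum_mul_sum]
  rw [Finset.sum_comm]
  refine Finset.sum_congr rfl fun a _ => ?_
  have h2 : ∀ e f b : G, (∑ x : G, (if a - e = x then 1 else 0) * if f - b = x then 1 else 0)
      = if a + b = e + f then 1 else 0 := by
    intro e f b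
    rw [Finset.sum_eq_single (a - e)]
    · rw [if_pos rfl, one_mul]
      refine if_congr ?_ rfl rfl
      constructor
      · intro h; rw [sub_eq_sub_iff_add_eq_add] at h; rw [add_comm e f, h]
      · intro h; rw [sub_eq_sub_iff_add_eq_add, h, add_comm]
    · intro x _ hx
      rw [if_neg (Ne.symm hx), zero_mul]
    · simp
  calc ∑ x : G, ∑ f ∈ D, ∑ e ∈ D, ∑ b ∈ D,
        ((if a - e = x then 1 else 0) * if f - b = x then 1 else 0)
      = ∑ f ∈ D, ∑ e ∈ D, ∑ b ∈ D, ∑ x : G,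
        ((if a - e = x then 1 else 0) * if f - b = x then 1 else 0) := by
        rw [Finset.sum_comm]
        refine Finset.sum_congr rfl fun f _ => ?_
        rw [Finset.sum_comm]
        refine Finset.sum_congr rfl fun e _ => ?_
        rw [Finset.sum_comm]
    _ = ∑ f ∈ D, ∑ e ∈ D, ∑ b ∈ D, if a + b = e + f then 1 else 0 := by simp_rw [h2]
    _ = ∑ f ∈ D, ∑ b ∈ D, ∑ e ∈ D, if a + b = e + f then 1 else 0 :=
        Finset.sum_congr rfl fun f _ => Finset.sum_comm
    _ = ∑ b ∈ D, ∑ f ∈ D, ∑ e ∈ D, if a + b = e + f then 1 else 0 := Finset.sum_comm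
    _ = _ := Finset.sum_congr rfl fun b _ => Finset.sum_comm

theorem card_le_of_invariant {F : Type*} [Field F] {Γ D : Finset F} (hD0 : (0 : F) ∉ D)
    (hD : ∀ x ∈ D, ∀ g ∈ Γ, x * g ∈ D) (hne : D.Nonempty) : Γ.card ≤ D.card := by
  obtain ⟨x, hx⟩ := hne
  have hx0 : x ≠ 0 := fun h => hD0 (h ▸ hx)
  exact Finset.card_le_card_of_injOn (fun g => x * g) (fun g hg => hD x hx g hg)
    fun g _ g' _ h => mul_left_cancel₀ hx0 h

open Polynomial in
theorem exists_field_extension.{u} (F : Type u) [Field F] (p : ℕ) [CharP F p] :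
    ∃ (K : Type u) (_ : Field K) (_ : Infinite K) (_ : CharP K p) (φ : F →+* K) (s : K),
      ∀ a b c d : F, φ a + φ b * s + φ c * s ^ 2 + φ d * s ^ 3 = 0 →
        a = 0 ∧ b = 0 ∧ c = 0 ∧ d = 0 := by
  have hinj := FaithfulSMul.algebraMap_injective F[X] (FractionRing F[X])
  refine ⟨FractionRing F[X], inferInstance, Infinite.of_injective _ hinj,
    charP_of_injective_algebraMap hinj p,
    (algebraMap F[X] (FractionRing F[X])).comp C, algebraMap F[X] (FractionRing F[X]) X,
    fun a b c d h => ?_⟩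
  have h1 : (C a + C b * X + C c * X ^ 2 + C d * X ^ 3 : F[X]) = 0 :=
    hinj (by rw [map_zero, ← h]; simp)
  have h2 : ∀ n, (C a + C b * X + C c * X ^ 2 + C d * X ^ 3 : F[X]).coeff n = 0 := by
    intro n; rw [h1, coeff_zero]
  have e0 := h2 0
  have e1 := h2 1
  have e2 := h2 2
  have e3 := h2 3
  simp [coeff_X, coeff_X_pow, coeff_C] at e0 e1 e2 e3
  exact ⟨e0, e1, e2, e3⟩

theorem lines_cross_iff {K : Type*} [Field K] {a b c d e f s : K} (hb : b ≠ 0) (hd : d ≠ 0)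
    (hP : 1 - s ^ 2 * c ≠ 0) (hR : f + s ^ 2 * e ≠ 0) :
    a * d + b = e + c * f ↔ ∃ x,
      (1 + s * d) / (f + s ^ 2 * e) = (1 - s ^ 2 * c) / b * x + c / b ∧
      (a - s * b) / (1 - s ^ 2 * c) = -((f + s ^ 2 * e) / d) * x + e / d := by
  have h1 : ∀ x, (1 + s * d) / (f + s ^ 2 * e) = (1 - s ^ 2 * c) / b * x + c / b ↔
      (1 + s * d) * b = ((1 - s ^ 2 * c) * x + c) * (f + s ^ 2 * e) := by
    intro x
    rw [div_mul_eq_mul_div, ← add_div, div_eq_div_iff hR hb]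
  have h2 : ∀ x, (a - s * b) / (1 - s ^ 2 * c) = -((f + s ^ 2 * e) / d) * x + e / d ↔
      (a - s * b) * d = (-(f + s ^ 2 * e) * x + e) * (1 - s ^ 2 * c) := by
    intro x
    rw [← neg_div, div_mul_eq_mul_div, ← add_div, div_eq_div_iff hP hd]
  simp_rw [h1, h2]
  constructor
  · intro h
    refine ⟨((1 + s * d) * b - c * (f + s ^ 2 * e)) /
      ((1 - s ^ 2 * c) * (f + s ^ 2 * e)), ?_⟩
    have hx : ((1 + s * d) * b - c * (f + s ^ 2 * e)) /
      ((1 - s ^ 2 * c) * (f + s ^ 2 * e)) * ((1 - s ^ 2 * c) * (f + s ^ 2 * e)) =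
        ((1 + s * d) * b - c * (f + s ^ 2 * e)) := div_mul_cancel₀ _ (mul_ne_zero hP hR)
    constructor
    · linear_combination -hx
    · linear_combination hx + h
  · rintro ⟨x, h1, h2⟩
    linear_combination h1 + h2

section energy
variable {F : Type*} [Field F] [DecidableEq F]

theorem sum_mul_of_invariant {Γ D : Finset F} (hΓ : IsMulSubgroup Γ)
    (hD : ∀ x ∈ D, ∀ g ∈ Γ, x * g ∈ D) {g : F} (hg : g ∈ Γ) {M : Type*} [AddCommMonoid M]
    (φ : F → M) : ∑ x ∈ D, φ (x * g) = ∑ x ∈ D, φ x := by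
  have hg0 : g ≠ 0 := fun h => hΓ.1 (h ▸ hg)
  refine Finset.sum_bij' (fun x _ => x * g) (fun x _ => x * g⁻¹) (fun x hx => hD x hx g hg)
    (fun x hx => hD x hx _ (hΓ.2.2.2 g hg)) ?_ ?_ fun _ _ => rfl
  · intro x _; field_simp
  · intro x _; field_simp

theorem sum_incidences [Fintype F] {Γ D : Finset F} (hΓ : IsMulSubgroup Γ)
    (hD : ∀ x ∈ D, ∀ g ∈ Γ, x * g ∈ D) :
    ∑ i ∈ D ×ˢ D ×ˢ Γ, ((Γ ×ˢ D ×ˢ D).filter fun j : F × F × F =>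
      i.1 * j.1 + i.2.1 = j.2.1 + i.2.2 * j.2.2).card = Γ.card ^ 2 * ∑ x : F, rsub D x ^ 2 := by
  have h1 : ∀ i : F × F × F, ((Γ ×ˢ D ×ˢ D).filter fun j : F × F × F =>
      i.1 * j.1 + i.2.1 = j.2.1 + i.2.2 * j.2.2).card =
      ∑ d ∈ Γ, ∑ e ∈ D, ∑ f ∈ D, if i.1 * d + i.2.1 = e + f * i.2.2 then 1 else 0 := by
    intro i
    rw [Finset.card_filter, Finset.sum_product]
    refine Finset.sum_congr rfl fun d _ => ?_
    rw [Finset.sum_product]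
    simp_rw [mul_comm i.2.2]
  simp_rw [h1]
  rw [Finset.sum_product]
  simp_rw [Finset.sum_product]
  calc ∑ a ∈ D, ∑ b ∈ D, ∑ c ∈ Γ, ∑ d ∈ Γ, ∑ e ∈ D, ∑ f ∈ D,
        (if a * d + b = e + f * c then 1 else 0)
      = ∑ a ∈ D, ∑ b ∈ D, ∑ c ∈ Γ, ∑ d ∈ Γ, ∑ e ∈ D, ∑ f ∈ D,
        (if a * d + b = e + f then 1 else 0) := by
        refine Finset.sum_congr rfl fun a _ => Finset.sum_congr rfl fun b _ =>
          Finset.sum_congr rfl fun c hc => Finset.sum_congr rfl fun d _ =>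
          Finset.sum_congr rfl fun e _ => ?_
        exact sum_mul_of_invariant hΓ hD hc fun f => if a * d + b = e + f then 1 else 0
    _ = Γ.card * ∑ a ∈ D, ∑ d ∈ Γ, ∑ b ∈ D, ∑ e ∈ D, ∑ f ∈ D,
        (if a * d + b = e + f then 1 else 0) := by
        rw [Finset.mul_sum]
        refine Finset.sum_congr rfl fun a _ => ?_
        rw [Finset.sum_comm, Finset.sum_const, smul_eq_mul, Finset.sum_comm]
    _ = Γ.card * ∑ d ∈ Γ, ∑ a ∈ D, ∑ b ∈ D, ∑ e ∈ D, ∑ f ∈ D,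
        (if a + b = e + f then 1 else 0) := by
        rw [Finset.sum_comm]
        congr 1
        refine Finset.sum_congr rfl fun d hd => ?_
        exact sum_mul_of_invariant hΓ hD hd fun a => ∑ b ∈ D, ∑ e ∈ D, ∑ f ∈ D,
          if a + b = e + f then 1 else 0
    _ = _ := by rw [Finset.sum_const, smul_eq_mul, sum_rsub_sq, pow_two, mul_assoc]

theorem card_common_planes_le {Γ D : Finset F} (hΓD : Γ.card ≤ D.card) (i i' : F × F × F)
    (hne : i ≠ i') :
    ((Γ ×ˢ D ×ˢ D).filter fun j : F × F × F => i.1 * j.1 + i.2.1 = j.2.1 + i.2.2 * j.2.2 ∧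
      i'.1 * j.1 + i'.2.1 = j.2.1 + i'.2.2 * j.2.2).card ≤ D.card := by
  obtain ⟨a, b, c⟩ := i
  obtain ⟨a', b', c'⟩ := i'
  by_cases hcc : c = c'
  · subst hcc
    by_cases haa : a = a'
    · subst haa
      refine (Finset.card_eq_zero.mpr ?_).trans_le (Nat.zero_le _)
      rw [Finset.filter_eq_empty_iff]
      rintro ⟨d, e, f⟩ _ ⟨h1, h2⟩
      apply hne
      have : b = b' := by linear_combination h1 - h2
      rw [this]
    · refine Finset.card_le_card_of_injOn (fun j => j.2.2) ?_ ?_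
      · rintro ⟨d, e, f⟩ h
        simp only [Finset.coe_filter, Finset.mem_product, Set.mem_ofPred_eq] at h
        exact h.1.2.2
      · rintro ⟨d, e, f⟩ h ⟨d', e', f'⟩ h' hff
        simp only [Finset.coe_filter, Finset.mem_product, Set.mem_ofPred_eq] at h h' hff
        subst hff
        have h3 : (a - a') * (d - d') = 0 := by
          linear_combination h.2.1 - h.2.2 - h'.2.1 + h'.2.2
        have h4 : d = d' := sub_eq_zero.mp
          ((mul_eq_zero.mp h3).resolve_left (sub_ne_zero.mpr haa))
        subst h4
        have h5 : e = e' := by linear_combination h'.2.1 - h.2.1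
        rw [h5]
  · refine le_trans ?_ hΓD
    refine Finset.card_le_card_of_injOn (fun j => j.1) ?_ ?_
    · rintro ⟨d, e, f⟩ h
      simp only [Finset.coe_filter, Finset.mem_product, Set.mem_ofPred_eq] at h
      exact h.1.1
    · rintro ⟨d, e, f⟩ h ⟨d', e', f'⟩ h' hff
      simp only [Finset.coe_filter, Finset.mem_product, Set.mem_ofPred_eq] at h h' hff
      subst hff
      have h3 : (c - c') * (f - f') = 0 := by
        linear_combination -h.2.1 + h.2.2 + h'.2.1 - h'.2.2
      have h4 : f = f' := sub_eq_zero.mp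
        ((mul_eq_zero.mp h3).resolve_left (sub_ne_zero.mpr hcc))
      subst h4
      have h5 : e = e' := by linear_combination h'.2.1 - h.2.1
      rw [h5]

/-- Bound on the number of solutions of `a * d + b = e + c * f` in invariant sets. -/
theorem sum_incidences_le {p : ℕ} [Fact p.Prime] {Γ D : Finset (ZMod p)}
    (hΓ : IsMulSubgroup Γ) (hD0 : (0 : ZMod p) ∉ D) (hΓD : Γ.card ≤ D.card)
    (hp : D.card ^ 2 * Γ.card ≤ p ^ 2) :
    ((∑ i ∈ D ×ˢ D ×ˢ Γ, ((Γ ×ˢ D ×ˢ D).filter fun j : ZMod p × ZMod p × ZMod p =>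
      i.1 * j.1 + i.2.1 = j.2.1 + i.2.2 * j.2.2).card : ℕ) : ℝ) ≤
      40000 * (D.card ^ 2 * Γ.card : ℕ) * √(D.card ^ 2 * Γ.card : ℕ) := by
  classical
  obtain ⟨K, _, _, _, φ, s, key⟩ := exists_field_extension (ZMod p) p
  have hP : ∀ c, 1 - s ^ 2 * φ c ≠ 0 := by
    intro c h
    have := (key 1 0 (-c) 0 (by rw [← h]; simp; ring)).1
    exact one_ne_zero this
  have hR : ∀ e f, f ≠ 0 → φ f + s ^ 2 * φ e ≠ 0 := by
    intro e f hf h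
    exact hf (key f 0 e 0 (by rw [← h]; simp; ring)).1
  have hφ : ∀ a, a ≠ 0 → φ a ≠ 0 := fun a ha => by simpa using ha
  have hD0' : ∀ a ∈ D, a ≠ 0 := fun a ha h => hD0 (h ▸ ha)
  have hΓ0' : ∀ a ∈ Γ, a ≠ 0 := fun a ha h => hΓ.1 (h ▸ ha)
  have hcardI : (D ×ˢ D ×ˢ Γ).card = D.card ^ 2 * Γ.card := by
    simp only [Finset.card_product]; ring
  have hcardJ : (Γ ×ˢ D ×ˢ D).card = D.card ^ 2 * Γ.card := by
    simp only [Finset.card_product]; ring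
  exact card_crossings_le (K := K) p (D ×ˢ D ×ˢ Γ) (Γ ×ˢ D ×ˢ D)
    (fun i => (1 - s ^ 2 * φ i.2.2) / φ i.2.1) (fun i => φ i.2.2 / φ i.2.1)
    (fun i => (φ i.1 - s * φ i.2.1) / (1 - s ^ 2 * φ i.2.2))
    (fun j => (1 + s * φ j.1) / (φ j.2.2 + s ^ 2 * φ j.2.1))
    (fun j => -((φ j.2.2 + s ^ 2 * φ j.2.1) / φ j.1)) (fun j => φ j.2.1 / φ j.1)
    (by
      rintro ⟨a, b, c⟩ hi ⟨a', b', c'⟩ hi' h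
      simp only [Finset.coe_product, Set.mem_prod, Finset.mem_coe] at hi hi' h
      rw [div_eq_div_iff (hP _) (hP _)] at h
      have h1 := key (a - a') (b' - b) (a' * c - a * c') (b * c' - b' * c) (by
        simp only [map_sub, map_mul]
        linear_combination h)
      obtain ⟨h1, h2, h3, -⟩ := h1
      have ha : a = a' := sub_eq_zero.mp h1
      have hb : b' = b := sub_eq_zero.mp h2
      subst ha hb
      have : a * (c - c') = 0 := by linear_combination h3
      have hc : c = c' := sub_eq_zero.mp ((mul_eq_zero.mp this).resolve_left (hD0' _ hi.1))
      rw [hc])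
    (by
      rintro ⟨d, e, f⟩ hi ⟨d', e', f'⟩ hi' h
      simp only [Finset.coe_product, Set.mem_prod, Finset.mem_coe] at hi hi' h
      have hf0 := hD0' _ hi.2.2
      rw [div_eq_div_iff (hR _ _ hf0) (hR _ _ (hD0' _ hi'.2.2))] at h
      obtain ⟨h1, h2, h3, -⟩ := key (f' - f) (d * f' - d' * f) (e' - e) (d * e' - d' * e) (by
        simp only [map_sub, map_mul]
        linear_combination h)
      have hf : f' = f := sub_eq_zero.mp h1
      have he : e' = e := sub_eq_zero.mp h3
      subst hf he
      have : f' * (d - d') = 0 := by linear_combination h2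
      have hd : d = d' := sub_eq_zero.mp ((mul_eq_zero.mp this).resolve_left hf0)
      rw [hd])
    (by
      rintro ⟨d, e, f⟩ hi
      simp only [Finset.mem_product] at hi
      exact neg_ne_zero.mpr (div_ne_zero (hR _ _ (hD0' _ hi.2.2)) (hφ _ (hΓ0' _ hi.1))))
    (fun i j => i.1 * j.1 + i.2.1 = j.2.1 + i.2.2 * j.2.2)
    (by
      rintro ⟨a, b, c⟩ hi ⟨d, e, f⟩ hj
      simp only [Finset.mem_product] at hi hj
      have hb := hφ _ (hD0' _ hi.2.1)
      have hd := hφ _ (hΓ0' _ hj.1)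
      have hφi : a * d + b = e + c * f ↔ φ a * φ d + φ b = φ e + φ c * φ f := by
        rw [← map_mul, ← map_mul, ← map_add, ← map_add]
        exact φ.injective.eq_iff.symm
      exact hφi.trans (lines_cross_iff hb hd (hP c) (hR e f (hD0' _ hj.2.2))))
    (D.card ^ 2 * Γ.card) D.card hp
    (Nat.le_mul_of_pos_right _ (Finset.card_pos.mpr ⟨1, hΓ.2.1⟩))
    hcardI.le hcardJ.le (fun i _ i' _ hii => card_common_planes_le hΓD i i' hii)

/-- Energy bound for a set invariant under a multiplicative subgroup. -/
theorem card_mul_energy_le {p : ℕ} [Fact p.Prime] {Γ D : Finset (ZMod p)}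
    (hΓ : IsMulSubgroup Γ) (hD0 : (0 : ZMod p) ∉ D) (hD : ∀ x ∈ D, ∀ g ∈ Γ, x * g ∈ D)
    (hp : D.card ^ 2 * Γ.card ≤ p ^ 2) :
    ((∑ x : ZMod p, rsub D x ^ 2 : ℕ) : ℝ) * √Γ.card ≤ 40000 * (D.card : ℝ) ^ 3 := by
  rcases D.eq_empty_or_nonempty with rfl | hne
  · simp [rsub]
  have main := sum_incidences_le hΓ hD0 (card_le_of_invariant hD0 hD hne) hp
  rw [sum_incidences hΓ hD] at main
  have ht : (0 : ℝ) < Γ.card := by exact_mod_cast Finset.card_pos.mpr ⟨1, hΓ.2.1⟩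
  push_cast at main ⊢
  rw [Real.sqrt_mul (by positivity), Real.sqrt_sq (by positivity)] at main
  have hsq := Real.mul_self_sqrt ht.le
  have hs : 0 < √(Γ.card : ℝ) := Real.sqrt_pos.mpr ht
  generalize √(Γ.card : ℝ) = w at *
  rw [← hsq] at main
  have h3 : (0:ℝ) < w ^ 3 := by positivity
  refine le_of_mul_le_mul_left ?_ h3
  linear_combination main

end energy

theorem exists_pos_pow_eq {a : ℝ} (ha : 0 < a) {n : ℕ} (hn : n ≠ 0) : ∃ θ : ℝ, 0 < θ ∧ θ ^ n = a :=
  ⟨a ^ (1 / (n : ℝ)), Real.rpow_pos_of_pos ha _, by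
    rw [one_div, Real.rpow_inv_natCast_pow ha.le hn]⟩

theorem sum_le_dyadic {X : Type*} (s : Finset X) (v : X → ℝ) (N : ℕ) (h1 : ∀ x ∈ s, 1 ≤ v x)
    (h2 : ∀ x ∈ s, v x < 2 ^ N) :
    ∑ x ∈ s, v x ≤ ∑ i ∈ range N, 2 ^ (i + 1) * ((s.filter fun x => 2 ^ i ≤ v x).card : ℝ) := by
  have h3 : ∀ i, 2 ^ (i + 1) * ((s.filter fun x => 2 ^ i ≤ v x).card : ℝ) =
      ∑ x ∈ s, if 2 ^ i ≤ v x then (2 : ℝ) ^ (i + 1) else 0 := by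
    intro i
    rw [← Finset.sum_filter, Finset.sum_const, nsmul_eq_mul, mul_comm]
  simp_rw [h3]
  rw [Finset.sum_comm]
  refine Finset.sum_le_sum fun x hx => ?_
  have hex : ∃ n, v x < 2 ^ n := ⟨N, h2 x hx⟩
  classical
  obtain ⟨i, hi⟩ : ∃ i, Nat.find hex = i + 1 := by
    refine Nat.exists_eq_succ_of_ne_zero fun h0 => ?_
    have := Nat.find_spec hex
    rw [h0, pow_zero] at this
    linarith [h1 x hx]
  have hiN : i < N := by
    have := Nat.find_min' hex (h2 x hx)
    omega
  have hlt : v x < 2 ^ (i + 1) := hi ▸ Nat.find_spec hex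
  have hle : 2 ^ i ≤ v x := not_lt.mp (Nat.find_min hex (by omega))
  have h4 := Finset.single_le_sum (f := fun i => if 2 ^ i ≤ v x then (2 : ℝ) ^ (i + 1) else 0)
    (fun i _ => by positivity) (Finset.mem_range.mpr hiN)
  rw [if_pos hle] at h4
  linarith

theorem sum_le_of_card_le {X : Type*} (s : Finset X) (v : X → ℝ) (A : ℝ) (hA : 0 ≤ A)
    (h1 : ∀ x ∈ s, 1 ≤ v x)
    (h2 : ∀ i : ℕ, ((s.filter fun x => 2 ^ i ≤ v x).card : ℝ) * 4 ^ i ≤ A) :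
    ∑ x ∈ s, v x ≤ 4 * A := by
  obtain ⟨N, hN⟩ := pow_unbounded_of_one_lt (∑ x ∈ s, v x) (one_lt_two : (1 : ℝ) < 2)
  have h3 : ∀ x ∈ s, v x < 2 ^ N := fun x hx =>
    (Finset.single_le_sum (fun y hy => zero_le_one.trans (h1 y hy)) hx).trans_lt hN
  have h4 : ∀ n : ℕ, ∑ i ∈ range n, 2 * A * (1 / 2 : ℝ) ^ i = 4 * A * (1 - (1 / 2) ^ n) := by
    intro n
    induction n with
    | zero => simp
    | succ n ih => rw [Finset.sum_range_succ, ih]; ring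
  calc ∑ x ∈ s, v x
      ≤ ∑ i ∈ range N, 2 ^ (i + 1) * ((s.filter fun x => 2 ^ i ≤ v x).card : ℝ) :=
        sum_le_dyadic s v N h1 h3
    _ ≤ ∑ i ∈ range N, 2 * A * (1 / 2 : ℝ) ^ i := by
        refine Finset.sum_le_sum fun i _ => ?_
        have h5 := h2 i
        have h6 : (4 : ℝ) ^ i = 2 ^ i * 2 ^ i := by rw [← mul_pow]; norm_num
        have h7 : (0 : ℝ) < 2 ^ i := by positivity
        rw [one_div, inv_pow, ← div_eq_mul_inv, le_div_iff₀ h7, pow_succ]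
        rw [h6] at h5
        linarith
    _ = 4 * A * (1 - (1 / 2) ^ N) := h4 N
    _ ≤ 4 * A := by
        have : (0 : ℝ) ≤ (1 / 2) ^ N := by positivity
        nlinarith

theorem rsub_zero {G : Type*} [AddCommGroup G] [DecidableEq G] (D : Finset G) : rsub D 0 = D.card := by
  rw [rsub, ← Finset.diag_card D]
  congr 1
  ext ⟨a, b⟩
  simp only [Finset.mem_filter, Finset.mem_product, Finset.mem_diag, sub_eq_zero]
  constructor
  · rintro ⟨⟨h, -⟩, e⟩; exact ⟨h, e⟩
  · rintro ⟨h, e⟩; exact ⟨⟨h, e ▸ h⟩, e⟩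

section levels
variable {G : Type*} [AddCommGroup G] [DecidableEq G] [Fintype G]

/-- The nonzero points where `ρ` is at least `u`. -/
noncomputable def level (ρ : G → ℝ) (u : ℝ) : Finset G :=
  univ.filter fun x => x ≠ 0 ∧ u ≤ ρ x

theorem mem_level {ρ : G → ℝ} {u : ℝ} {x : G} : x ∈ level ρ u ↔ x ≠ 0 ∧ u ≤ ρ x := by
  simp [level]

theorem sum_tail_le (ρ : G → ℝ) (B : ℝ) (hB : 0 ≤ B) (g : ℕ) (hg : g ≠ 0)
    (hW : ∀ u, 0 < u → ((level ρ u).card : ℝ) * u ^ (4 * g) ≤ B) (u₀ : ℝ) (hu : 0 < u₀) :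
    ∑ x ∈ level ρ u₀, (ρ x - u₀) ^ 2 ≤ 4 * u₀ ^ 2 * (B / u₀ ^ (4 * g)) / g ^ 2 := by
  have hgpos : (0 : ℝ) < g := by exact_mod_cast Nat.pos_of_ne_zero hg
  have h1 : ∀ x ∈ level ρ u₀, 1 ≤ ρ x / u₀ := fun x hx =>
    (one_le_div hu).mpr (mem_level.mp hx).2
  have h2 : ∀ x ∈ level ρ u₀, (ρ x - u₀) ^ 2 ≤ u₀ ^ 2 / g ^ 2 * (ρ x / u₀) ^ (2 * g) := by
    intro x hx
    have h3 := one_add_mul_le_pow (a := ρ x / u₀ - 1) (by linarith [h1 x hx]) g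
    have h4 : 0 ≤ g * (ρ x / u₀ - 1) := mul_nonneg hgpos.le (by linarith [h1 x hx])
    have h5 : g * (ρ x / u₀ - 1) ≤ (ρ x / u₀) ^ g := by
      rw [add_sub_cancel] at h3; linarith
    have h6 := pow_le_pow_left₀ h4 h5 2
    rw [← pow_mul, mul_comm g 2] at h6
    calc (ρ x - u₀) ^ 2 = u₀ ^ 2 / g ^ 2 * (g * (ρ x / u₀ - 1)) ^ 2 := by field_simp
      _ ≤ _ := mul_le_mul_of_nonneg_left h6 (by positivity)
  have h7 : ∑ x ∈ level ρ u₀, (ρ x / u₀) ^ (2 * g) ≤ 4 * (B / u₀ ^ (4 * g)) := by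
    refine sum_le_of_card_le _ _ _ (by positivity) (fun x hx => one_le_pow₀ (h1 x hx)) fun i => ?_
    obtain ⟨θ, hθ, hθi⟩ := exists_pos_pow_eq (a := (2 : ℝ) ^ i) (by positivity)
      (n := 2 * g) (by omega)
    have h8 := hW (u₀ * θ) (by positivity)
    have h9 : (((level ρ u₀).filter fun x => 2 ^ i ≤ (ρ x / u₀) ^ (2 * g)).card : ℝ) ≤
        (level ρ (u₀ * θ)).card := by
      refine Nat.cast_le.mpr (Finset.card_le_card fun x hx => ?_)
      rw [Finset.mem_filter, ← hθi] at hx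
      refine mem_level.mpr ⟨(mem_level.mp hx.1).1, ?_⟩
      have := le_of_pow_le_pow_left₀ (by omega) (by linarith [h1 x hx.1]) hx.2
      rwa [le_div_iff₀ hu, mul_comm] at this
    have h10 : θ ^ (4 * g) = 4 ^ i := by
      rw [show 4 * g = 2 * g * 2 by ring, pow_mul, hθi, ← pow_mul, mul_comm, pow_mul]; norm_num
    rw [mul_pow, h10] at h8
    rw [le_div_iff₀ (by positivity)]
    calc _ ≤ ((level ρ (u₀ * θ)).card : ℝ) * 4 ^ i * u₀ ^ (4 * g) := by gcongr
      _ ≤ B := by linarith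
  calc _ ≤ ∑ x ∈ level ρ u₀, u₀ ^ 2 / g ^ 2 * (ρ x / u₀) ^ (2 * g) := Finset.sum_le_sum h2
    _ = u₀ ^ 2 / g ^ 2 * ∑ x ∈ level ρ u₀, (ρ x / u₀) ^ (2 * g) := by rw [Finset.mul_sum]
    _ ≤ u₀ ^ 2 / g ^ 2 * (4 * (B / u₀ ^ (4 * g))) :=
        mul_le_mul_of_nonneg_left h7 (by positivity)
    _ = _ := by ring

theorem sum_rsub (D : Finset G) : ∑ x : G, rsub D x = D.card ^ 2 := by
  rw [pow_two, ← Finset.card_product,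
    Finset.card_eq_sum_card_fiberwise (f := fun ab : G × G => ab.1 - ab.2) (t := univ)
      (fun _ _ => Finset.mem_coe.mpr (Finset.mem_univ _))]
  rfl

theorem sum_rsub_mul_le (ρ : G → ℝ) (h0 : ρ 0 ≤ 1) (D : Finset G) (u₀ : ℝ) (hu : 0 ≤ u₀) :
    ∑ z : G, (rsub D z : ℝ) * ρ z ≤ D.card + u₀ * D.card ^ 2 +
      √((∑ z : G, (rsub D z : ℝ) ^ 2) * ∑ x ∈ level ρ u₀, (ρ x - u₀) ^ 2) := by
  have h1 : ∀ z, (rsub D z : ℝ) * ρ z ≤ (if z = 0 then (rsub D z : ℝ) else 0) +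
      u₀ * rsub D z + if z ∈ level ρ u₀ then (rsub D z : ℝ) * (ρ z - u₀) else 0 := by
    intro z
    have hr : (0 : ℝ) ≤ rsub D z := Nat.cast_nonneg _
    by_cases hz : z = 0
    · subst hz
      rw [if_pos rfl, if_neg (fun h => (mem_level.mp h).1 rfl)]
      nlinarith [mul_le_mul_of_nonneg_left h0 hr, mul_nonneg hu hr]
    · rw [if_neg hz]
      split_ifs with h
      · linarith
      · rw [mem_level] at h
        push Not at h
        nlinarith [h hz]
  have h2 : ∑ z ∈ level ρ u₀, (rsub D z : ℝ) * (ρ z - u₀) ≤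
      √((∑ z : G, (rsub D z : ℝ) ^ 2) * ∑ x ∈ level ρ u₀, (ρ x - u₀) ^ 2) := by
    refine Real.le_sqrt_of_sq_le ?_
    refine (Finset.sum_mul_sq_le_sq_mul_sq _ _ _).trans ?_
    refine mul_le_mul_of_nonneg_right ?_ (Finset.sum_nonneg fun _ _ => sq_nonneg _)
    exact Finset.sum_le_sum_of_subset_of_nonneg (Finset.subset_univ _) fun _ _ _ => sq_nonneg _
  have h3 : ∑ z : G, (rsub D z : ℝ) = (D.card : ℝ) ^ 2 := by exact_mod_cast sum_rsub D
  refine (Finset.sum_le_sum fun z _ => h1 z).trans ?_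
  rw [Finset.sum_add_distrib, Finset.sum_add_distrib, Finset.sum_ite_eq' univ (0 : G), ← mul_sum,
    h3, if_pos (Finset.mem_univ _), rsub_zero, Finset.sum_ite_mem, Finset.univ_inter]
  linarith

/-- Large values of the difference function correlate with differences of large values. -/
theorem card_sq_mul_le (Q D : Finset G) (w : ℝ) (hw : 0 ≤ w) (hD : ∀ x ∈ D, w ≤ rsub Q x) :
    (w * D.card) ^ 2 ≤ Q.card * ∑ z : G, (rsub D z : ℝ) * rsub Q z := by
  have h1 : ∀ x, rsub Q x = (Q.filter fun a => a + x ∈ Q).card := by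
    intro x
    rw [rsub]
    refine Finset.card_bij' (fun ab _ => ab.2) (fun a _ => (a + x, a)) ?_ ?_ ?_ ?_
    · rintro ⟨a, b⟩ h
      simp only [Finset.mem_filter, Finset.mem_product] at h ⊢
      obtain ⟨⟨ha, hb⟩, rfl⟩ := h
      exact ⟨hb, by simpa using ha⟩
    · intro a h
      simp only [Finset.mem_filter, Finset.mem_product] at h ⊢
      exact ⟨⟨h.2, h.1⟩, by abel⟩
    · rintro ⟨a, b⟩ h
      simp only [Finset.mem_filter, Finset.mem_product] at h ⊢
      obtain ⟨-, rfl⟩ := h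
      simp
    · intro a _; rfl
  have h2 : ∑ x ∈ D, rsub Q x = ∑ a ∈ Q, (D.filter fun x => a + x ∈ Q).card := by
    simp_rw [h1, Finset.card_filter]
    exact Finset.sum_comm
  have h3 : w * D.card ≤ ∑ a ∈ Q, ((D.filter fun x => a + x ∈ Q).card : ℝ) := by
    have : ((∑ x ∈ D, rsub Q x : ℕ) : ℝ) = ∑ a ∈ Q, ((D.filter fun x => a + x ∈ Q).card : ℝ) := by
      rw [h2]; push_cast; rfl
    rw [← this, mul_comm, ← nsmul_eq_mul]
    push_cast
    exact Finset.card_nsmul_le_sum _ _ _ hD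
  have h4 : ∑ a ∈ Q, (D.filter fun x => a + x ∈ Q).card ^ 2 ≤ ∑ z : G, rsub D z * rsub Q z := by
    have h5 : ∑ z : G, rsub D z * rsub Q z = ∑ x ∈ D, ∑ y ∈ D, rsub Q (x - y) := by
      rw [← Finset.sum_product (s := D) (t := D) (f := fun ab => rsub Q (ab.1 - ab.2)),
        ← Finset.sum_fiberwise_of_maps_to (s := D ×ˢ D) (t := univ)
          (g := fun ab : G × G => ab.1 - ab.2) (fun _ _ => Finset.mem_univ _)]
      refine Finset.sum_congr rfl fun z _ => ?_
      rw [Finset.sum_congr rfl (g := fun _ => rsub Q z) fun ab h => by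
        rw [(Finset.mem_filter.mp h).2], Finset.sum_const, smul_eq_mul, rsub]
    rw [h5]
    have h6 : ∀ a, (D.filter fun x => a + x ∈ Q).card ^ 2 =
        ∑ x ∈ D, ∑ y ∈ D, if a + x ∈ Q ∧ a + y ∈ Q then 1 else 0 := by
      intro a
      rw [pow_two, Finset.card_filter, Finset.sum_mul_sum]
      refine Finset.sum_congr rfl fun x _ => Finset.sum_congr rfl fun y _ => ?_
      rw [ite_and]
      split_ifs <;> simp
    simp_rw [h6]
    rw [Finset.sum_comm]
    refine Finset.sum_le_sum fun x _ => ?_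
    rw [Finset.sum_comm]
    refine Finset.sum_le_sum fun y _ => ?_
    rw [← Finset.card_filter, rsub]
    refine Finset.card_le_card_of_injOn (fun a => (a + x, a + y)) ?_ ?_
    · intro a h
      simp only [Finset.coe_filter, Set.mem_ofPred_eq, Finset.mem_product] at h ⊢
      exact ⟨h.2, by abel⟩
    · intro a _ b _ h
      exact add_right_cancel (Prod.mk.inj h).1
  calc (w * D.card) ^ 2 ≤ (∑ a ∈ Q, ((D.filter fun x => a + x ∈ Q).card : ℝ)) ^ 2 :=
        pow_le_pow_left₀ (by positivity) h3 2
    _ ≤ Q.card * ∑ a ∈ Q, ((D.filter fun x => a + x ∈ Q).card : ℝ) ^ 2 := sq_sum_le_card_mul_sum_sq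
    _ ≤ _ := by
        refine mul_le_mul_of_nonneg_left ?_ (Nat.cast_nonneg _)
        exact_mod_cast h4

end levels

theorem moment_doubling {d u T B c₀ u₀ S E : ℝ} {g : ℕ} (hg : g ≠ 0) (hd : 0 < d)
    (hT : 0 < T) (hc : 0 < c₀) (hu₀ : 0 < u₀)
    (hB : d * u₀ ^ (4 * g) * T = c₀ * B) (hS : S ≤ 4 * u₀ ^ 2 * (B / u₀ ^ (4 * g)) / g ^ 2)
    (hE : E * T ≤ c₀ * d ^ 3) (hE0 : 0 ≤ E)
    (hmain : d ^ 2 * u ^ 2 ≤ d + u₀ * d ^ 2 + √(E * S)) (hbig : 2 * (4 * g) ≤ d * u ^ 2) :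
    d * u ^ (2 * (4 * g)) * T ≤ 2 * 3 ^ 8 * c₀ * B := by
  have hgpos : (1 : ℝ) ≤ g := by exact_mod_cast Nat.pos_of_ne_zero hg
  have h1 : B / u₀ ^ (4 * g) = d * T / c₀ := by
    rw [div_eq_div_iff (by positivity) hc.ne']
    linarith
  have h2 : E * S ≤ (2 * u₀ * d ^ 2 / g) ^ 2 := by
    rw [h1] at hS
    have h3 : E ≤ c₀ * d ^ 3 / T := by rwa [le_div_iff₀ hT]
    calc E * S ≤ E * (4 * u₀ ^ 2 * (d * T / c₀) / g ^ 2) := mul_le_mul_of_nonneg_left hS hE0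
      _ ≤ c₀ * d ^ 3 / T * (4 * u₀ ^ 2 * (d * T / c₀) / g ^ 2) :=
        mul_le_mul_of_nonneg_right h3 (by positivity)
      _ = _ := by field_simp; norm_num
  have h3 : √(E * S) ≤ 2 * u₀ * d ^ 2 / g := Real.sqrt_le_iff.mpr ⟨by positivity, h2⟩
  have h4 : d ≤ d ^ 2 * u ^ 2 * (1 / (8 * g)) := by
    rw [mul_one_div, le_div_iff₀ (by positivity)]
    have := mul_le_mul_of_nonneg_left hbig hd.le
    linarith
  have h5 : u ^ 2 * (1 + -(1 / (8 * g))) ≤ u₀ * (2 / g + 1) := by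
    have hd2 : 0 < d ^ 2 := by positivity
    refine le_of_mul_le_mul_left ?_ hd2
    have h6 : 2 * u₀ * d ^ 2 / g = d ^ 2 * u₀ * (2 / g) := by ring
    linarith
  have h7 : 1 / (8 * (g : ℝ)) ≤ 1 / 8 := by
    apply one_div_le_one_div_of_le <;> linarith
  have h8 := pow_le_pow_left₀ (mul_nonneg (sq_nonneg u) (by linarith)) h5 (4 * g)
  rw [mul_pow, mul_pow, ← pow_mul] at h8
  have h9 : (1 / 2 : ℝ) ≤ (1 + -(1 / (8 * (g : ℝ)))) ^ (4 * g) := by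
    refine le_trans ?_ (one_add_mul_le_pow (by linarith) (4 * g))
    push_cast
    field_simp
    norm_num
  have h10 : (2 / (g : ℝ) + 1) ^ (4 * g) ≤ 3 ^ 8 := by
    calc (2 / (g : ℝ) + 1) ^ (4 * g) ≤ Real.exp (2 / g) ^ (4 * g) :=
          pow_le_pow_left₀ (by positivity) (Real.add_one_le_exp _) _
      _ = Real.exp 1 ^ 8 := by
          rw [← Real.exp_nat_mul, ← Real.exp_nat_mul]
          congr 1
          push_cast
          field_simp
          norm_num
      _ ≤ 3 ^ 8 := pow_le_pow_left₀ (Real.exp_nonneg _) (by linarith [Real.exp_one_lt_d9]) 8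
  have h11 : u ^ (2 * (4 * g)) * (1 / 2) ≤ u₀ ^ (4 * g) * 3 ^ 8 := by
    have hu : 0 ≤ u ^ (2 * (4 * g)) := by rw [pow_mul]; positivity
    exact (mul_le_mul_of_nonneg_left h9 hu).trans
      (h8.trans (mul_le_mul_of_nonneg_left h10 (by positivity)))
  have h12 := mul_le_mul_of_nonneg_left h11 (mul_nonneg hd.le hT.le)
  linear_combination 2 * h12 + 2 * 3 ^ 8 * hB

theorem moment_doubling_base {d u T q c₀ S E : ℝ} (hd : 0 < d) (hT : 0 < T)
    (hS : S * T ≤ c₀ * q) (hE : E * T ≤ c₀ * d ^ 3) (hE0 : 0 ≤ E) (hS0 : 0 ≤ S)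
    (hmain : d ^ 2 * u ^ 2 ≤ d + √(E * S)) (hbig : 2 ≤ d * u ^ 2) :
    d * u ^ 4 * T ^ 2 ≤ (2 * c₀) ^ 2 * q := by
  have h1 : d * 2 ≤ d * (d * u ^ 2) := mul_le_mul_of_nonneg_left hbig hd.le
  have h2 : d ^ 2 * u ^ 2 / 2 ≤ √(E * S) := by linarith
  have h3 := pow_le_pow_left₀ (by positivity) h2 2
  rw [Real.sq_sqrt (mul_nonneg hE0 hS0)] at h3
  have h4 : (E * T) * (S * T) ≤ (c₀ * d ^ 3) * (c₀ * q) :=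
    mul_le_mul hE hS (by positivity) (le_trans (by positivity) hE)
  have h5 : 0 < d ^ 3 := by positivity
  refine le_of_mul_le_mul_left ?_ h5
  have h6 := mul_le_mul_of_nonneg_right h3 (sq_nonneg T)
  linear_combination 4 * h6 + 4 * h4

section levels
variable {G : Type*} [AddCommGroup G] [DecidableEq G] [Fintype G]

theorem level_card_mul_pow_two_mul_le {ρ : G → ℝ} (hρ : ∀ x, ρ x ≤ 1) {q T c M : ℝ} {j m : ℕ}
    (hq : 0 < q) (hc : 0 < c) (hcT : c ≤ T) (hM : 0 ≤ M) (hj : j ≠ 0)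
    (hW : ∀ u, 0 < u → ((level ρ u).card : ℝ) * u ^ m ≤ max (c ^ j * q / T ^ j) M)
    (hcore : ∀ u, 0 < u → u ≤ 1 → 0 < (level ρ u).card → ((level ρ u).card : ℝ) ≤ q →
      M ≤ c ^ j * q / T ^ j →
      ((level ρ u).card : ℝ) * u ^ (2 * m) ≤ max (c ^ (j + 1) * q / T ^ (j + 1)) M)
    (u : ℝ) (hu : 0 < u) :
    ((level ρ u).card : ℝ) * u ^ (2 * m) ≤ max (c ^ (j + 1) * q / T ^ (j + 1)) M := by
  have hT : 0 < T := hc.trans_le hcT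
  rcases Nat.eq_zero_or_pos (level ρ u).card with h0 | hpos
  · rw [h0, Nat.cast_zero, zero_mul]
    exact hM.trans (le_max_right _ _)
  have hu1 : u ≤ 1 := by
    obtain ⟨x, hx⟩ := Finset.card_pos.mp hpos
    exact (mem_level.mp hx).2.trans (hρ x)
  have hd : (0 : ℝ) < (level ρ u).card := by exact_mod_cast hpos
  have hWu := hW u hu
  have hsplit : ((level ρ u).card : ℝ) * u ^ (2 * m) = (level ρ u).card * u ^ m * u ^ m := by ring
  have hum : u ^ m ≤ 1 := pow_le_one₀ hu.le hu1
  have hum0 : 0 ≤ u ^ m := by positivity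
  rcases lt_or_ge (c ^ j * q / T ^ j) M with hMb | hMb
  · rw [max_eq_right hMb.le] at hWu
    refine le_trans ?_ (le_max_right _ _)
    rw [hsplit]
    nlinarith
  by_cases hdq : ((level ρ u).card : ℝ) ≤ q
  · exact hcore u hu hu1 hpos hdq hMb
  push Not at hdq
  rw [max_eq_left hMb] at hWu
  refine le_trans ?_ (le_max_left _ _)
  have h1 : u ^ m ≤ (c / T) ^ j := by
    have h2 : q * u ^ m ≤ q * (c / T) ^ j := by
      calc q * u ^ m ≤ (level ρ u).card * u ^ m := mul_le_mul_of_nonneg_right hdq.le hum0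
        _ ≤ _ := hWu
        _ = _ := by rw [div_pow]; ring
    exact le_of_mul_le_mul_left h2 hq
  have h3 : (c / T) ^ j ≤ c / T := pow_le_of_le_one (by positivity) ((div_le_one hT).mpr hcT) hj
  rw [hsplit]
  calc ((level ρ u).card : ℝ) * u ^ m * u ^ m ≤ c ^ j * q / T ^ j * (c / T) :=
        mul_le_mul hWu (h1.trans h3) hum0 (by positivity)
    _ = _ := by rw [pow_succ, pow_succ]; field_simp

theorem level_card_mul_pow_le {ρ : G → ℝ} (hρ : ∀ x, ρ x ≤ 1)
    {q T c₀ M : ℝ} (hq : 0 < q) (hc₀ : 1 ≤ c₀) (hcT : 2 * 3 ^ 8 * c₀ ≤ T)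
    (hE : ∀ u, 0 < u → ((level ρ u).card : ℝ) ≤ q →
      (∑ z : G, (rsub (level ρ u) z : ℝ) ^ 2) * T ≤ c₀ * ((level ρ u).card : ℝ) ^ 3)
    (hcorr : ∀ u, 0 < u →
      ((level ρ u).card : ℝ) ^ 2 * u ^ 2 ≤ ∑ z : G, (rsub (level ρ u) z : ℝ) * ρ z)
    (h2 : (∑ x, ρ x ^ 2) * T ≤ c₀ * q) (k : ℕ) (hM : 2 ^ (k + 1) ≤ M) (j : ℕ) (hjk : j ≤ k) :
    ∀ u, 0 < u → ((level ρ u).card : ℝ) * u ^ (2 ^ (j + 1)) ≤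
      max ((2 * 3 ^ 8 * c₀) ^ (j + 1) * q / T ^ (j + 1)) M := by
  have hc₀pos : 0 < c₀ := by linarith
  set c := 2 * 3 ^ 8 * c₀ with hc
  have hcpos : 0 < c := by positivity
  have hT : 0 < T := hcpos.trans_le hcT
  have hM0 : 0 ≤ M := le_trans (by positivity) hM
  induction j with
  | zero =>
    intro u hu
    refine le_trans ?_ (le_max_left _ _)
    rw [zero_add, pow_one, pow_one, pow_one, le_div_iff₀ hT]
    have h3 : ((level ρ u).card : ℝ) * u ^ 2 ≤ ∑ x, ρ x ^ 2 := by
      rw [← nsmul_eq_mul]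
      calc (level ρ u).card • u ^ 2 ≤ ∑ x ∈ level ρ u, ρ x ^ 2 :=
            Finset.card_nsmul_le_sum _ _ _ fun x hx =>
              pow_le_pow_left₀ hu.le (mem_level.mp hx).2 2
        _ ≤ _ := Finset.sum_le_sum_of_subset_of_nonneg (Finset.subset_univ _)
              fun _ _ _ => sq_nonneg _
    calc ((level ρ u).card : ℝ) * u ^ 2 * T ≤ (∑ x, ρ x ^ 2) * T :=
          mul_le_mul_of_nonneg_right h3 hT.le
      _ ≤ c₀ * q := h2
      _ ≤ c * q := mul_le_mul_of_nonneg_right (by rw [hc]; linarith) hq.le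
  | succ j ih =>
    have hW := ih (by omega)
    have hMj : (2 : ℝ) * 2 ^ (j + 1) ≤ M := by
      refine le_trans ?_ hM
      rw [← pow_succ']
      exact pow_le_pow_right₀ (by norm_num) (by omega)
    rw [show 2 ^ (j + 1 + 1) = 2 * 2 ^ (j + 1) by ring]
    refine level_card_mul_pow_two_mul_le hρ hq hcpos hcT hM0 (Nat.succ_ne_zero j) hW ?_
    intro u hu hu1 hpos hdq hMb
    have hd : (0 : ℝ) < (level ρ u).card := by exact_mod_cast hpos
    have hsum0 : (0 : ℝ) ≤ ∑ z : G, (rsub (level ρ u) z : ℝ) ^ 2 :=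
      Finset.sum_nonneg fun _ _ => sq_nonneg _
    by_cases hbig : 2 * 2 ^ (j + 1) ≤ ((level ρ u).card : ℝ) * u ^ 2
    swap
    · refine le_trans ?_ (le_max_right _ _)
      refine le_trans ?_ ((not_le.mp hbig).le.trans hMj)
      refine mul_le_mul_of_nonneg_left ?_ hd.le
      exact pow_le_pow_of_le_one hu.le hu1 (by
        have : 0 < 2 ^ (j + 1) := by positivity
        omega)
    refine le_trans ?_ (le_max_left _ _)
    rw [le_div_iff₀ (by positivity)]
    cases j with
    | zero =>
      have h3 := sum_rsub_mul_le ρ (hρ 0) (level ρ u) 0 le_rfl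
      simp only [sub_zero, zero_mul, add_zero] at h3
      have h4 : ∑ x ∈ level ρ 0, ρ x ^ 2 ≤ ∑ x, ρ x ^ 2 :=
        Finset.sum_le_sum_of_subset_of_nonneg (Finset.subset_univ _) fun _ _ _ => sq_nonneg _
      have h5 := moment_doubling_base (u := u) hd hT
        ((mul_le_mul_of_nonneg_right h4 hT.le).trans h2) (hE u hu hdq) hsum0
        (Finset.sum_nonneg fun _ _ => sq_nonneg _) ((hcorr u hu).trans h3)
        (by simp at hbig; linarith)
      refine h5.trans (mul_le_mul_of_nonneg_right ?_ hq.le)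
      exact pow_le_pow_left₀ (by positivity) (by rw [hc]; linarith) 2
    | succ i =>
      set b := c ^ (i + 1 + 1) * q / T ^ (i + 1 + 1) with hb
      have hbpos : 0 < b := by positivity
      rw [max_eq_left hMb] at hW
      have hpow : 2 ^ (i + 1 + 1) = 4 * 2 ^ i := by ring
      rw [hpow] at hW ⊢
      obtain ⟨u₀, hu₀, hu₀'⟩ := exists_pos_pow_eq (a := c₀ * b / (T * (level ρ u).card))
        (by positivity) (n := 4 * 2 ^ i) (by positivity)
      have h5 := moment_doubling (u := u) (B := b) (g := 2 ^ i) (by positivity) hd hT hc₀pos hu₀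
        (by rw [hu₀']; field_simp)
        (sum_tail_le ρ b hbpos.le (2 ^ i) (by positivity) hW u₀ hu₀)
        (hE u hu hdq) hsum0 ((hcorr u hu).trans (sum_rsub_mul_le ρ (hρ 0) (level ρ u) u₀ hu₀.le))
        (by
          refine le_trans (le_of_eq ?_) hbig
          push_cast; ring)
      rw [pow_succ T, mul_comm (T ^ (i + 1 + 1)), ← mul_assoc]
      calc _ ≤ c * b * T ^ (i + 1 + 1) := mul_le_mul_of_nonneg_right h5 (by positivity)
        _ = _ := by rw [hb]; field_simp; ring

end levels

theorem sum_pow_le_of_level {G : Type*} [AddCommGroup G] [DecidableEq G] [Fintype G] (r : G → ℕ)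
    (q : ℕ) (hq : 0 < q) (hr : ∀ x, r x ≤ q) (M N : ℕ) (hM : M ≠ 0) (B : ℝ)
    (hW : ∀ u, 0 < u → ((level (fun x => (r x : ℝ) / q) u).card : ℝ) * u ^ M ≤ B)
    (hN : (q : ℝ) ^ M < 2 ^ N) :
    ∑ x, (r x : ℝ) ^ M ≤ (q : ℝ) ^ M * (1 + 2 * N * B) := by
  have hq0 : (0 : ℝ) < q := by exact_mod_cast hq
  set s := univ.filter fun x => x ≠ 0 ∧ 1 ≤ r x with hs
  have h1 : ∑ x, (r x : ℝ) ^ M ≤ (q : ℝ) ^ M + ∑ x ∈ s, (r x : ℝ) ^ M := by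
    rw [← Finset.add_sum_erase _ _ (Finset.mem_univ (0 : G))]
    refine add_le_add (pow_le_pow_left₀ (by positivity) (by exact_mod_cast hr 0) M) ?_
    refine (Finset.sum_subset_zero_on_sdiff ?_ ?_ fun _ _ => rfl).ge
    · intro x hx
      rw [hs, Finset.mem_filter] at hx
      exact Finset.mem_erase.mpr ⟨hx.2.1, Finset.mem_univ _⟩
    · intro x hx
      rw [Finset.mem_sdiff, Finset.mem_erase, hs, Finset.mem_filter] at hx
      have : r x = 0 := by
        by_contra h0
        exact hx.2 ⟨Finset.mem_univ _, hx.1.1, Nat.pos_of_ne_zero h0⟩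
      rw [this, Nat.cast_zero, zero_pow hM]
  have h2 := sum_le_dyadic s (fun x => (r x : ℝ) ^ M) N
    (fun x hx => one_le_pow₀ (by exact_mod_cast (Finset.mem_filter.mp hx).2.2))
    (fun x _ => (pow_le_pow_left₀ (by positivity) (by exact_mod_cast hr x) M).trans_lt hN)
  have h3 : ∀ i ∈ range N, 2 ^ (i + 1) * ((s.filter fun x => 2 ^ i ≤ (r x : ℝ) ^ M).card : ℝ) ≤
      2 * B * (q : ℝ) ^ M := by
    intro i _
    obtain ⟨θ, hθ, hθi⟩ := exists_pos_pow_eq (a := (2 : ℝ) ^ i) (by positivity) hM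
    have h4 := hW (θ / q) (by positivity)
    have h5 : ((s.filter fun x => 2 ^ i ≤ (r x : ℝ) ^ M).card : ℝ) ≤
        (level (fun x => (r x : ℝ) / q) (θ / q)).card := by
      refine Nat.cast_le.mpr (Finset.card_le_card fun x hx => ?_)
      rw [Finset.mem_filter, hs, Finset.mem_filter, ← hθi] at hx
      refine mem_level.mpr ⟨hx.1.2.1, ?_⟩
      have := le_of_pow_le_pow_left₀ hM (by positivity) hx.2
      exact div_le_div_of_nonneg_right this hq0.le
    rw [div_pow, hθi, mul_div_assoc', div_le_iff₀ (by positivity)] at h4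
    rw [pow_succ]
    have h6 := mul_le_mul_of_nonneg_right h5 (by positivity : (0 : ℝ) ≤ 2 ^ i)
    linarith
  have h7 := Finset.sum_le_sum h3
  rw [Finset.sum_const, Finset.card_range, nsmul_eq_mul] at h7
  linarith

theorem logb_two_le {x : ℝ} (hx : 1 ≤ x) : Real.logb 2 x ≤ 4 * √x := by
  have hs : 0 < √x := Real.sqrt_pos.mpr (by linarith)
  have h1 : Real.log x = 2 * Real.log (√x) := by
    rw [Real.log_sqrt (by linarith)]; ring
  have h2 := Real.log_le_sub_one_of_pos hs
  have h3 := Real.log_two_gt_d9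
  rw [Real.logb, div_le_iff₀ (by linarith), h1]
  nlinarith

theorem one_add_log_mul_max_le {c T q : ℝ} {k N : ℕ} (hk : 1 ≤ k) (hc : 1 ≤ c)
    (hT : 2 ^ (32 * k) ≤ T) (hq : 2 ≤ q) (hqT : q * Real.logb 2 q ^ (4 * k) ≤ T ^ (k + 2))
    (hN : (N : ℝ) ≤ 2 ^ (k + 1) * Real.logb 2 q + 1) :
    1 + 2 * N * max (c ^ (k + 1) * q / T ^ (k + 1)) (2 ^ (k + 1)) ≤ (2 ^ 8 * c) ^ (k + 1) * T := by
  set L := Real.logb 2 q with hL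
  have hL1 : 1 ≤ L := by
    rw [hL, Real.le_logb_iff_rpow_le (by norm_num) (by linarith)]
    simpa using hq
  have hT1 : 1 ≤ T := le_trans (one_le_pow₀ (by norm_num)) hT
  have hTpos : 0 < T := by linarith
  have hL0 : 0 < L := by linarith
  have hP1 : (1 : ℝ) ≤ 2 ^ (k + 1) := one_le_pow₀ (by norm_num)
  have hN2 : (N : ℝ) ≤ 2 * 2 ^ (k + 1) * L := by nlinarith
  have hcpow : (1 : ℝ) ≤ c ^ (k + 1) := one_le_pow₀ hc
  have hL4 : L ≤ L ^ (4 * k) := le_self_pow₀ hL1 (by omega)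
  have hfirst : L * (c ^ (k + 1) * q / T ^ (k + 1)) ≤ c ^ (k + 1) * T := by
    rw [mul_div_assoc', div_le_iff₀ (by positivity)]
    calc L * (c ^ (k + 1) * q) = c ^ (k + 1) * (q * L) := by ring
      _ ≤ c ^ (k + 1) * (q * L ^ (4 * k)) := by gcongr
      _ ≤ c ^ (k + 1) * T ^ (k + 2) := by gcongr
      _ = _ := by ring
  have hLk : L ≤ (k + 2) * (4 * √T) := by
    have h1 : q ≤ T ^ (k + 2) := by
      refine le_trans ?_ hqT
      have : 1 ≤ L ^ (4 * k) := one_le_pow₀ hL1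
      nlinarith
    calc L ≤ Real.logb 2 (T ^ (k + 2)) :=
          Real.logb_le_logb_of_le (by norm_num) (by linarith) h1
      _ = (k + 2) * Real.logb 2 T := by rw [Real.logb_pow]; push_cast; ring
      _ ≤ _ := mul_le_mul_of_nonneg_left (logb_two_le hT1) (by positivity)
  have hsT : (2 : ℝ) ^ (16 * k) ≤ √T := by
    refine Real.le_sqrt_of_sq_le ?_
    rw [← pow_mul]
    refine le_trans (le_of_eq ?_) hT
    congr 1; ring
  have hk2 : (k : ℝ) + 2 ≤ 2 ^ (k + 1) := by
    have : k + 2 ≤ 2 ^ (k + 1) := Nat.lt_two_pow_self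
    exact_mod_cast this
  have hsecond : L * 2 ^ (k + 1) ≤ T := by
    have h2 : (k + 2 : ℝ) * 4 * 2 ^ (k + 1) ≤ √T := by
      calc (k + 2 : ℝ) * 4 * 2 ^ (k + 1) ≤ 2 ^ (k + 1) * 4 * 2 ^ (k + 1) := by gcongr
        _ = 2 ^ (2 * k + 4) := by ring
        _ ≤ 2 ^ (16 * k) := pow_le_pow_right₀ (by norm_num) (by omega)
        _ ≤ _ := hsT
    have h3 := Real.mul_self_sqrt hTpos.le
    calc L * 2 ^ (k + 1) ≤ (k + 2) * (4 * √T) * 2 ^ (k + 1) := by gcongr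
      _ = (k + 2 : ℝ) * 4 * 2 ^ (k + 1) * √T := by ring
      _ ≤ √T * √T := mul_le_mul_of_nonneg_right h2 (Real.sqrt_nonneg _)
      _ = T := h3
  have hmax : L * max (c ^ (k + 1) * q / T ^ (k + 1)) (2 ^ (k + 1)) ≤ c ^ (k + 1) * T := by
    rw [mul_max_of_nonneg _ _ hL0.le]
    refine max_le hfirst (hsecond.trans ?_)
    exact le_mul_of_one_le_left hTpos.le hcpow
  have hmax0 : 0 ≤ max (c ^ (k + 1) * q / T ^ (k + 1)) (2 ^ (k + 1)) :=
    le_trans (by positivity) (le_max_right _ _)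
  have h8 : (2 ^ 8 : ℝ) ^ (k + 1) = 2 ^ (k + 1) * 128 ^ (k + 1) := by
    rw [← mul_pow]; norm_num
  have h128 : (128 : ℝ) ≤ 128 ^ (k + 1) := le_self_pow₀ (by norm_num) (by omega)
  have hcT : 1 ≤ c ^ (k + 1) * T := by nlinarith
  calc 1 + 2 * N * max (c ^ (k + 1) * q / T ^ (k + 1)) (2 ^ (k + 1))
      ≤ 1 + 2 * (2 * 2 ^ (k + 1) * L) * max (c ^ (k + 1) * q / T ^ (k + 1)) (2 ^ (k + 1)) := by
        gcongr
    _ = 1 + 4 * 2 ^ (k + 1) * (L * max (c ^ (k + 1) * q / T ^ (k + 1)) (2 ^ (k + 1))) := by ring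
    _ ≤ 2 ^ (k + 1) * (c ^ (k + 1) * T) + 4 * 2 ^ (k + 1) * (c ^ (k + 1) * T) := by
        refine add_le_add ?_ (mul_le_mul_of_nonneg_left hmax (by positivity))
        exact one_le_mul_of_one_le_of_one_le hP1 hcT
    _ = 2 ^ (k + 1) * 5 * (c ^ (k + 1) * T) := by ring
    _ ≤ 2 ^ (k + 1) * 128 ^ (k + 1) * (c ^ (k + 1) * T) := by
        have : (5 : ℝ) ≤ 128 ^ (k + 1) := by linarith
        gcongr
    _ = _ := by rw [mul_pow, h8]; ring

theorem rsub_le_card {G : Type*} [AddCommGroup G] [DecidableEq G] (Q : Finset G) (x : G) :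
    rsub Q x ≤ Q.card := by
  refine Finset.card_le_card_of_injOn (fun ab => ab.1) ?_ ?_
  · intro ab h
    simp only [Finset.coe_filter, Set.mem_ofPred_eq, Finset.mem_product] at h
    exact h.1.1
  · rintro ⟨a, b⟩ h ⟨a', b'⟩ h' hab
    simp only [Finset.coe_filter, Set.mem_ofPred_eq, Finset.mem_product] at h h' hab
    have h1 := h.2.trans h'.2.symm
    rw [hab] at h1 ⊢
    rw [sub_right_inj.mp h1]

theorem rsub_mul {F : Type*} [Field F] [DecidableEq F] {Γ Q : Finset F} (hΓ : IsMulSubgroup Γ)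
    (hQ : ∀ x ∈ Q, ∀ g ∈ Γ, x * g ∈ Q) (x : F) {g : F} (hg : g ∈ Γ) :
    rsub Q (x * g) = rsub Q x := by
  have h1 : ∀ x, ∀ g ∈ Γ, rsub Q x ≤ rsub Q (x * g) := by
    intro x g hg
    have hg0 : g ≠ 0 := fun h => hΓ.1 (h ▸ hg)
    refine Finset.card_le_card_of_injOn (fun ab => (ab.1 * g, ab.2 * g)) ?_ ?_
    · intro ab h
      simp only [Finset.coe_filter, Set.mem_ofPred_eq, Finset.mem_product] at h ⊢
      exact ⟨⟨hQ _ h.1.1 g hg, hQ _ h.1.2 g hg⟩, by rw [← sub_mul, h.2]⟩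
    · rintro ⟨a, b⟩ _ ⟨a', b'⟩ _ h
      simp only [Prod.mk.injEq] at h
      rw [mul_right_cancel₀ hg0 h.1, mul_right_cancel₀ hg0 h.2]
  refine le_antisymm ?_ (h1 x g hg)
  have hg0 : g ≠ 0 := fun h => hΓ.1 (h ▸ hg)
  have := h1 (x * g) g⁻¹ (hΓ.2.2.2 g hg)
  rwa [mul_inv_cancel_right₀ hg0] at this

end SkewLines

/-- there is an absolute constant `C ≥ 1` such that for every odd prime `p`,
every multiplicative subgroup `Γ ⊆ F_p^*`, every `Q ⊆ F_p^*` with `QΓ = Q` and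
`|Q|²|Γ| ≤ p²`, and every integer `k ≥ 1` with `2^{64k} C⁴ ≤ |Γ|` and
`|Γ|^{(k+2)/2} ≥ |Q|(log|Q|)^{4k}`, one has
`E⁺_{2^{k+1}}(Q) ≤ (2⁸C)^{k+1} |Q|^{2^{k+1}} |Γ|^{1/2}`. -/
theorem stmt_8 :
    ∃ C : ℝ, 1 ≤ C ∧
      ∀ (p : ℕ) [Fact p.Prime], Odd p →
        ∀ (Γ Q : Finset (ZMod p)), IsMulSubgroup Γ →
          (0 : ZMod p) ∉ Q → Q * Γ = Q →
          ((Q.card : ℝ) ^ 2 * Γ.card ≤ (p : ℝ) ^ 2) →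
          ∀ k : ℕ, 1 ≤ k → (2 : ℝ) ^ (64 * k) * C ^ 4 ≤ Γ.card →
            (Q.card : ℝ) * (Real.logb 2 Q.card) ^ (4 * k) ≤
              (Γ.card : ℝ) ^ (((k : ℝ) + 2) / 2) →
            (Ek (2 ^ (k + 1)) Q : ℝ) ≤
              (2 ^ 8 * C) ^ (k + 1) * (Q.card : ℝ) ^ (2 ^ (k + 1)) * Real.sqrt Γ.card := by
  refine ⟨2 * 3 ^ 8 * 40000, by norm_num, ?_⟩
  intro p _ _ Γ Q hΓ hQ0 hQΓ hp k hk ht hlog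
  set c : ℝ := 2 * 3 ^ 8 * 40000 with hc
  have hc1 : 1 ≤ c := by norm_num [hc]
  have hQ : ∀ x ∈ Q, ∀ g ∈ Γ, x * g ∈ Q := fun x hx g hg => hQΓ ▸ Finset.mul_mem_mul hx hg
  rcases Q.eq_empty_or_nonempty with rfl | hne
  · simp [Ek, rsub]
  have hpN : Q.card ^ 2 * Γ.card ≤ p ^ 2 := by exact_mod_cast hp
  have hΓQ := SkewLines.card_le_of_invariant hQ0 hQ hne
  have hqpos : 0 < Q.card := hne.card_pos
  have hq0 : (0 : ℝ) < Q.card := by exact_mod_cast hqpos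
  set T := √(Γ.card : ℝ) with hT
  have hTT : T ^ 2 = Γ.card := Real.sq_sqrt (Nat.cast_nonneg _)
  have hTbig : 2 ^ (32 * k) * c ^ 2 ≤ T := by
    refine Real.le_sqrt_of_sq_le (le_trans (le_of_eq ?_) ht)
    rw [mul_pow, ← pow_mul, ← pow_mul]
    congr 2; ring
  have h32 : (1 : ℝ) ≤ 2 ^ (32 * k) := one_le_pow₀ (by norm_num)
  have hcc : c ≤ c ^ 2 := le_self_pow₀ hc1 two_ne_zero
  have hcT : c ≤ T := by nlinarith
  have h2T : 2 ^ (32 * k) ≤ T := by nlinarith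
  have hT1 : 1 ≤ T := hc1.trans hcT
  have hTpos : 0 < T := by linarith
  have hq2 : (2 : ℝ) ≤ Q.card := by
    have h1 : (Γ.card : ℝ) ≤ Q.card := by exact_mod_cast hΓQ
    have h2 : (2 : ℝ) ≤ 2 ^ (32 * k) := le_self_pow₀ (by norm_num) (by omega)
    nlinarith
  have hlog' : (Q.card : ℝ) * (Real.logb 2 Q.card) ^ (4 * k) ≤ T ^ (k + 2) := by
    refine hlog.trans (le_of_eq ?_)
    rw [hT, Real.sqrt_eq_rpow, ← Real.rpow_mul_natCast (Nat.cast_nonneg _)]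
    congr 1
    push_cast; ring
  have hρ : ∀ x, (rsub Q x : ℝ) / Q.card ≤ 1 := fun x =>
    div_le_one_of_le₀ (by exact_mod_cast SkewLines.rsub_le_card Q x) hq0.le
  have hW := SkewLines.level_card_mul_pow_le (ρ := fun x => (rsub Q x : ℝ) / Q.card) hρ hq0
    (c₀ := 40000) (T := T) (M := 2 ^ (k + 1)) (by norm_num) hcT
    (by
      intro u hu hd
      have hd' : (SkewLines.level (fun x => (rsub Q x : ℝ) / Q.card) u).card ≤ Q.card := by
        exact_mod_cast hd
      have := SkewLines.card_mul_energy_le (D := SkewLines.level (fun x => (rsub Q x : ℝ) / Q.card) u)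
        hΓ (fun h => (SkewLines.mem_level.mp h).1 rfl)
        (by
          intro x hx g hg
          rw [SkewLines.mem_level] at hx ⊢
          refine ⟨mul_ne_zero hx.1 fun h => hΓ.1 (h ▸ hg), ?_⟩
          rw [SkewLines.rsub_mul hΓ hQ x hg]
          exact hx.2)
        ((Nat.mul_le_mul_right _ (Nat.pow_le_pow_left hd' 2)).trans hpN)
      push_cast at this
      exact this)
    (by
      intro u hu
      have h1 := SkewLines.card_sq_mul_le Q
        (SkewLines.level (fun x => (rsub Q x : ℝ) / Q.card) u) (u * Q.card) (by positivity)
        fun x hx => (le_div_iff₀ hq0).mp (SkewLines.mem_level.mp hx).2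
      have h2 : 0 < (Q.card : ℝ) ^ 2 := by positivity
      refine le_of_mul_le_mul_left ?_ h2
      have h3 : (Q.card : ℝ) ^ 2 * ∑ z : ZMod p,
          (rsub (SkewLines.level (fun x => (rsub Q x : ℝ) / Q.card) u) z : ℝ) *
            ((rsub Q z : ℝ) / Q.card) = Q.card * ∑ z : ZMod p,
          (rsub (SkewLines.level (fun x => (rsub Q x : ℝ) / Q.card) u) z : ℝ) * rsub Q z := by
        rw [Finset.mul_sum, Finset.mul_sum]
        refine Finset.sum_congr rfl fun z _ => ?_
        field_simp
      rw [h3]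
      refine le_trans (le_of_eq ?_) h1
      ring)
    (by
      have h1 := SkewLines.card_mul_energy_le hΓ hQ0 hQ hpN
      push_cast at h1
      simp_rw [div_pow]
      rw [← Finset.sum_div, div_mul_eq_mul_div, div_le_iff₀ (by positivity)]
      refine h1.trans (le_of_eq ?_)
      ring) k le_rfl k le_rfl
  have hL : 0 ≤ Real.logb 2 Q.card := Real.logb_nonneg (by norm_num) (by linarith)
  have hN : (Q.card : ℝ) ^ 2 ^ (k + 1) < 2 ^ (⌊2 ^ (k + 1) * Real.logb 2 Q.card⌋₊ + 1) := by
    rw [← Real.rpow_natCast 2, ← Real.logb_lt_iff_lt_rpow (by norm_num) (by positivity),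
      Real.logb_pow]
    push_cast
    exact Nat.lt_floor_add_one _
  have h1 := SkewLines.sum_pow_le_of_level (rsub Q) Q.card hqpos (SkewLines.rsub_le_card Q)
    (2 ^ (k + 1)) _ (by positivity) _ hW hN
  have h2 := SkewLines.one_add_log_mul_max_le (N := ⌊2 ^ (k + 1) * Real.logb 2 Q.card⌋₊ + 1) hk hc1 h2T hq2
    hlog' (by
      push_cast
      have := Nat.floor_le (mul_nonneg (by positivity : (0 : ℝ) ≤ 2 ^ (k + 1)) hL)
      linarith)
  rw [Ek]
  push_cast
  refine h1.trans ((mul_le_mul_of_nonneg_left h2 (by positivity)).trans (le_of_eq ?_))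
  ring
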